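/- Let x = x̂ ⊗ t_λ ⊗ z_{−∞} with x̂ = (…, x_2, x_1) ∈ X+, and suppose that x* is extremal. Then γ_{k+1}·p_{k+1} − p_k + x_k − γ_{k+1}·x_{k+1} ≥ 0 for every k ≥ 1. -/

import Mathlib

open Filter Function

namespace HypCrystal

variable (a1 a2 k1 k2 : ℤ)

/-- `i_k`: 1 if `k` is odd, 2 if `k` is even. -/
def idx (k : ℤ) : ℤ := if k % 2 = 1 then 1 else 2

/-- membership in the index set `I = {1,2}`. -/
def IsI (i : ℤ) : Prop := i = 1 ∨ i = 2

/-- `⟨α_{i_j}, α_{i_k}^∨⟩`. -/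
def pairJK (j k : ℤ) : ℤ :=
  if j % 2 = k % 2 then 2 else if k % 2 = 1 then -a1 else -a2

/-- `⟨α_{i_j}, α_i^∨⟩` for `i ∈ {1,2}`. -/
def pairJI (j i : ℤ) : ℤ :=
  if idx j = i then 2 else if i = 1 then -a1 else -a2

/-- `α_{i_j}` in the `(Λ1, Λ2)`-coordinates. -/
def alphaOf (j : ℤ) : ℤ × ℤ := if j % 2 = 1 then (2, -a2) else (-a1, 2)

/-- `⟨ν, α_i^∨⟩` for a weight `ν` in `(Λ1, Λ2)`-coordinates. -/
def pairW (ν : ℤ × ℤ) (i : ℤ) : ℤ := if i = 1 then ν.1 else ν.2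

/-- the sequence `c_j`. -/
def cseq : ℕ → ℤ
  | 0 => 0
  | 1 => 1
  | j + 2 => (if j % 2 = 0 then a1 else a2) * cseq (j + 1) - cseq j

/-- the sequence `c'_j`. -/
def cseq' : ℕ → ℤ
  | 0 => 0
  | 1 => 1
  | j + 2 => (if j % 2 = 0 then a2 else a1) * cseq' (j + 1) - cseq' j

noncomputable def alphaR : ℝ :=
  ((a1 : ℝ) * a2 + Real.sqrt ((a1 : ℝ) ^ 2 * (a2 : ℝ) ^ 2 - 4 * a1 * a2)) / (2 * a2)

noncomputable def betaR : ℝ :=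
  ((a1 : ℝ) * a2 + Real.sqrt ((a1 : ℝ) ^ 2 * (a2 : ℝ) ^ 2 - 4 * a1 * a2)) / (2 * a1)

/-- `γ_k = α` if `k` even, `β` if `k` odd. -/
noncomputable def gammaR (k : ℤ) : ℝ := if k % 2 = 0 then alphaR a1 a2 else betaR a1 a2

/-- `p_m` for `m ≥ 0`. -/
def ppos : ℕ → ℤ
  | 0 => k2
  | 1 => k1
  | m + 2 => (if m % 2 = 0 then a2 else a1) * ppos (m + 1) - ppos m

/-- `p_{-n}` for `n ≥ 0`. -/
def pneg : ℕ → ℤ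
  | 0 => k2
  | 1 => a1 * k2 - k1
  | n + 2 => (if (n + 2) % 2 = 0 then a2 else a1) * pneg (n + 1) - pneg n

/-- the two-sided sequence `p_m`, `m ∈ ℤ`, with `p_0 = k2`, `p_1 = k1`. -/
def pseq (m : ℤ) : ℤ :=
  if 0 ≤ m then ppos a1 a2 k1 k2 m.toNat else pneg a1 a2 k1 k2 (-m).toNat

/-- `λ = k1·Λ1 − k2·Λ2` in `(Λ1, Λ2)`-coordinates. -/
def lamW : ℤ × ℤ := (k1, -k2)

/-- membership in `ℤ^{+∞}` (coordinates supported on positions `≥ 1`, nonnegative,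
finitely supported). -/
def ZPlusMem (x : ℤ → ℤ) : Prop :=
  (∀ k : ℤ, k ≤ 0 → x k = 0) ∧ (∀ k : ℤ, 0 ≤ x k) ∧ ∃ N : ℕ, ∀ k : ℤ, (N : ℤ) < k → x k = 0

/-- membership in `ℤ^{−∞}` (coordinates supported on positions `≤ 0`, nonpositive,
finitely supported). -/
def ZMinusMem (x : ℤ → ℤ) : Prop :=
  (∀ k : ℤ, 1 ≤ k → x k = 0) ∧ (∀ k : ℤ, x k ≤ 0) ∧ ∃ N : ℕ, ∀ k : ℤ, k < -(N : ℤ) → x k = 0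

/-- membership in `X+ = Img(Ψ⁺)`. -/
def XPlusMem (x : ℤ → ℤ) : Prop :=
  ZPlusMem x ∧ ∀ j : ℤ, 1 ≤ j →
    0 ≤ cseq a1 a2 j.toNat * x j - cseq a1 a2 (j - 1).toNat * x (j + 1)

/-- membership in `X− = Img(Ψ⁻)`. -/
def XMinusMem (x : ℤ → ℤ) : Prop :=
  ZMinusMem x ∧ ∀ j : ℤ, j ≤ 0 →
    cseq' a1 a2 (1 - j).toNat * x j - cseq' a1 a2 (-j).toNat * x (j - 1) ≤ 0

def posPart (x : ℤ → ℤ) : ℤ → ℤ := fun k => if 1 ≤ k then x k else 0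
def negPart (x : ℤ → ℤ) : ℤ → ℤ := fun k => if k ≤ 0 then x k else 0

/-- membership in `Z_ι(μ) = ℤ^{+∞} ⊗ t_μ ⊗ ℤ^{−∞}` (in coordinates). -/
def ZMem (x : ℤ → ℤ) : Prop := ZPlusMem (posPart x) ∧ ZMinusMem (negPart x)

/-- membership in `X+ ⊗ t_λ ⊗ X−` (in coordinates). -/
def XXMem (x : ℤ → ℤ) : Prop := XPlusMem a1 a2 (posPart x) ∧ XMinusMem a1 a2 (negPart x)

/-- `σ_k` on `ℤ^{+∞}` (for `k ≥ 1`). -/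
noncomputable def sigmaP (x : ℤ → ℤ) (k : ℤ) : ℤ :=
  x k + ∑ᶠ j : ℤ, if k < j then pairJK a1 a2 j k * x j else 0

/-- `σ_k` on `ℤ^{−∞}` (for `k ≤ 0`). -/
noncomputable def sigmaM (x : ℤ → ℤ) (k : ℤ) : ℤ :=
  -(x k) - ∑ᶠ j : ℤ, if j < k then pairJK a1 a2 j k * x j else 0

/-- `−Σ_j x_j α_{i_j}` in `(Λ1, Λ2)`-coordinates. -/
noncomputable def wtOf (x : ℤ → ℤ) : ℤ × ℤ :=
  (-∑ᶠ j : ℤ, x j * (alphaOf a1 a2 j).1, -∑ᶠ j : ℤ, x j * (alphaOf a1 a2 j).2)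

/-- `wt(x) = μ − Σ_j x_j α_{i_j}`. -/
noncomputable def wtZ (μ : ℤ × ℤ) (x : ℤ → ℤ) : ℤ × ℤ := μ + wtOf a1 a2 x

/-- `σ_k` on `Z_ι(μ)`. -/
noncomputable def sigmaZ (μ : ℤ × ℤ) (x : ℤ → ℤ) (k : ℤ) : ℤ :=
  if 1 ≤ k then sigmaP a1 a2 x k
  else sigmaM a1 a2 x k - pairW (wtZ a1 a2 μ x) (idx k)

/-- `ε_i` on `Z_ι(μ)`. -/
noncomputable def epsZ (μ : ℤ × ℤ) (x : ℤ → ℤ) (i : ℤ) : ℤ :=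
  sSup {s : ℤ | ∃ k : ℤ, idx k = i ∧ sigmaZ a1 a2 μ x k = s}

/-- `φ_i` on `Z_ι(μ)`. -/
noncomputable def phiZ (μ : ℤ × ℤ) (x : ℤ → ℤ) (i : ℤ) : ℤ :=
  epsZ a1 a2 μ x i + pairW (wtZ a1 a2 μ x) i

noncomputable def kmaxZ (μ : ℤ × ℤ) (x : ℤ → ℤ) (i : ℤ) : ℤ :=
  sSup {k : ℤ | idx k = i ∧ sigmaZ a1 a2 μ x k = epsZ a1 a2 μ x i}

noncomputable def kminZ (μ : ℤ × ℤ) (x : ℤ → ℤ) (i : ℤ) : ℤ :=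
  sInf {k : ℤ | idx k = i ∧ sigmaZ a1 a2 μ x k = epsZ a1 a2 μ x i}

/-- `ẽ_i` on `Z_ι(μ)`; `none` represents `0`. -/
noncomputable def eZ (μ : ℤ × ℤ) (i : ℤ) (x : ℤ → ℤ) : Option (ℤ → ℤ) :=
  if 0 < epsZ a1 a2 μ x i then
    some (Function.update x (kmaxZ a1 a2 μ x i) (x (kmaxZ a1 a2 μ x i) - 1))
  else none

/-- `f̃_i` on `Z_ι(μ)`; `none` represents `0`. -/
noncomputable def fZ (μ : ℤ × ℤ) (i : ℤ) (x : ℤ → ℤ) : Option (ℤ → ℤ) :=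
  if 0 < phiZ a1 a2 μ x i then
    some (Function.update x (kminZ a1 a2 μ x i) (x (kminZ a1 a2 μ x i) + 1))
  else none

/-- `ε_i` on `ℤ^{+∞}`. -/
noncomputable def epsP (x : ℤ → ℤ) (i : ℤ) : ℤ :=
  sSup {s : ℤ | ∃ k : ℤ, 1 ≤ k ∧ idx k = i ∧ sigmaP a1 a2 x k = s}

noncomputable def kmaxP (x : ℤ → ℤ) (i : ℤ) : ℤ :=
  sSup {k : ℤ | 1 ≤ k ∧ idx k = i ∧ sigmaP a1 a2 x k = epsP a1 a2 x i}

noncomputable def kminP (x : ℤ → ℤ) (i : ℤ) : ℤ :=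
  sInf {k : ℤ | 1 ≤ k ∧ idx k = i ∧ sigmaP a1 a2 x k = epsP a1 a2 x i}

/-- `ẽ_i` on `ℤ^{+∞}` (partial). -/
noncomputable def eP (i : ℤ) (x : ℤ → ℤ) : Option (ℤ → ℤ) :=
  if 0 < epsP a1 a2 x i then
    some (Function.update x (kmaxP a1 a2 x i) (x (kmaxP a1 a2 x i) - 1))
  else none

/-- `f̃_i` on `ℤ^{+∞}` (total). -/
noncomputable def fP (i : ℤ) (x : ℤ → ℤ) : ℤ → ℤ :=
  Function.update x (kminP a1 a2 x i) (x (kminP a1 a2 x i) + 1)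

/-- `φ_i` on `ℤ^{−∞}`. -/
noncomputable def phiMf (x : ℤ → ℤ) (i : ℤ) : ℤ :=
  sSup {s : ℤ | ∃ k : ℤ, k ≤ 0 ∧ idx k = i ∧ sigmaM a1 a2 x k = s}

noncomputable def kmaxM (x : ℤ → ℤ) (i : ℤ) : ℤ :=
  sSup {k : ℤ | k ≤ 0 ∧ idx k = i ∧ sigmaM a1 a2 x k = phiMf a1 a2 x i}

noncomputable def kminM (x : ℤ → ℤ) (i : ℤ) : ℤ :=
  sInf {k : ℤ | k ≤ 0 ∧ idx k = i ∧ sigmaM a1 a2 x k = phiMf a1 a2 x i}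

/-- `ẽ_i` on `ℤ^{−∞}` (total). -/
noncomputable def eM (i : ℤ) (x : ℤ → ℤ) : ℤ → ℤ :=
  Function.update x (kmaxM a1 a2 x i) (x (kmaxM a1 a2 x i) - 1)

noncomputable def fPiter (i : ℤ) (n : ℕ) (x : ℤ → ℤ) : ℤ → ℤ := (fP a1 a2 i)^[n] x

noncomputable def eMiter (i : ℤ) (n : ℕ) (x : ℤ → ℤ) : ℤ → ℤ := (eM a1 a2 i)^[n] x

noncomputable def ePiterO (i : ℤ) (n : ℕ) (ox : Option (ℤ → ℤ)) : Option (ℤ → ℤ) :=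
  (fun o => o.bind (eP a1 a2 i))^[n] ox

noncomputable def eZiterO (μ : ℤ × ℤ) (i : ℤ) (n : ℕ) (ox : Option (ℤ → ℤ)) : Option (ℤ → ℤ) :=
  (fun o => o.bind (eZ a1 a2 μ i))^[n] ox

noncomputable def fZiterO (μ : ℤ × ℤ) (i : ℤ) (n : ℕ) (ox : Option (ℤ → ℤ)) : Option (ℤ → ℤ) :=
  (fun o => o.bind (fZ a1 a2 μ i))^[n] ox

noncomputable def suppBoundP (x : ℤ → ℤ) : ℕ := sInf {N : ℕ | ∀ k : ℤ, (N : ℤ) < k → x k = 0}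

noncomputable def suppBoundM (x : ℤ → ℤ) : ℕ := sInf {N : ℕ | ∀ k : ℤ, k < -(N : ℤ) → x k = 0}

/-- `starPChain x n z = f̃_{i_1}^{x_1} ⋯ f̃_{i_n}^{x_n} (z)` on `ℤ^{+∞}`. -/
noncomputable def starPChain (x : ℤ → ℤ) : ℕ → (ℤ → ℤ) → (ℤ → ℤ)
  | 0, z => z
  | n + 1, z => starPChain x n (fPiter a1 a2 (idx ((n : ℤ) + 1)) ((x ((n : ℤ) + 1)).toNat) z)

/-- the `∗`-operation on `X+`: `(x⁺)* = f̃_{i_1}^{x_1} ⋯ f̃_{i_N}^{x_N} (z_∞)`. -/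
noncomputable def starP (x : ℤ → ℤ) : ℤ → ℤ :=
  starPChain a1 a2 x (suppBoundP x) (fun _ => 0)

/-- `starMChain x n z = ẽ_{i_0}^{−x_0} ⋯ ẽ_{i_{-(n-1)}}^{−x_{-(n-1)}} (z)` on `ℤ^{−∞}`. -/
noncomputable def starMChain (x : ℤ → ℤ) : ℕ → (ℤ → ℤ) → (ℤ → ℤ)
  | 0, z => z
  | n + 1, z => starMChain x n (eMiter a1 a2 (idx (-(n : ℤ))) ((-(x (-(n : ℤ)))).toNat) z)

/-- the `∗`-operation on `X−`. -/
noncomputable def starM (x : ℤ → ℤ) : ℤ → ℤ :=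
  starMChain a1 a2 x (suppBoundM x + 1) (fun _ => 0)

/-- combine a `ℤ^{+∞}`- and a `ℤ^{−∞}`-component into an element of `Z_ι(μ)`. -/
def combine (y z : ℤ → ℤ) : ℤ → ℤ := fun k => if 1 ≤ k then y k else z k

/-- the coordinates of `x* = (x⁺)* ⊗ t_μ ⊗ (x⁻)*`. -/
noncomputable def xstarFun (x : ℤ → ℤ) : ℤ → ℤ :=
  combine (starP a1 a2 (posPart x)) (starM a1 a2 (negPart x))

/-- the weight `μ = −λ − wt(x⁺) − wt(x⁻)` of `x*`. -/
noncomputable def mustar (lam : ℤ × ℤ) (x : ℤ → ℤ) : ℤ × ℤ :=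
  -lam - wtOf a1 a2 (posPart x) - wtOf a1 a2 (negPart x)

/-- `fPnegChain g n z = f̃_{i_{-(n-1)}}^{g(-(n-1))} ⋯ f̃_{i_{-1}}^{g(-1)} f̃_{i_0}^{g 0} (z)`. -/
noncomputable def fPnegChain (g : ℤ → ℕ) : ℕ → (ℤ → ℤ) → (ℤ → ℤ)
  | 0, z => z
  | n + 1, z => fPiter a1 a2 (idx (-(n : ℤ))) (g (-(n : ℤ))) (fPnegChain g n z)

/-- `eMposChain g n z = ẽ_{i_n}^{g n} ⋯ ẽ_{i_2}^{g 2} ẽ_{i_1}^{g 1} (z)`. -/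
noncomputable def eMposChain (g : ℤ → ℕ) : ℕ → (ℤ → ℤ) → (ℤ → ℤ)
  | 0, z => z
  | n + 1, z => eMiter a1 a2 (idx ((n : ℤ) + 1)) (g ((n : ℤ) + 1)) (eMposChain g n z)

/-- `ePposChainO g n z = ẽ_{i_n}^{g n} ⋯ ẽ_{i_2}^{g 2} ẽ_{i_1}^{g 1} (z)` on `ℤ^{+∞}`. -/
noncomputable def ePposChainO (g : ℤ → ℕ) : ℕ → Option (ℤ → ℤ) → Option (ℤ → ℤ)
  | 0, z => z
  | n + 1, z => ePiterO a1 a2 (idx ((n : ℤ) + 1)) (g ((n : ℤ) + 1)) (ePposChainO g n z)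

/-- the Weyl group action `S_i` on `Z_ι(μ) ∪ {0}`. -/
noncomputable def SiO (μ : ℤ × ℤ) (i : ℤ) (ob : Option (ℤ → ℤ)) : Option (ℤ → ℤ) :=
  ob.bind fun b =>
    if 0 ≤ pairW (wtZ a1 a2 μ b) i then
      fZiterO a1 a2 μ i (pairW (wtZ a1 a2 μ b) i).toNat (some b)
    else eZiterO a1 a2 μ i (-(pairW (wtZ a1 a2 μ b) i)).toNat (some b)

/-- `SwPos μ n = S_{i_n} ⋯ S_{i_2} S_{i_1}`. -/
noncomputable def SwPos (μ : ℤ × ℤ) : ℕ → Option (ℤ → ℤ) → Option (ℤ → ℤ)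
  | 0, b => b
  | n + 1, b => SiO a1 a2 μ (idx ((n : ℤ) + 1)) (SwPos μ n b)

/-- `SwNeg μ n = S_{i_{-(n-1)}} ⋯ S_{i_{-1}} S_{i_0}`. -/
noncomputable def SwNeg (μ : ℤ × ℤ) : ℕ → Option (ℤ → ℤ) → Option (ℤ → ℤ)
  | 0, b => b
  | n + 1, b => SiO a1 a2 μ (idx (-(n : ℤ))) (SwNeg μ n b)

/-- `S_{w_k}`. -/
noncomputable def Swk (μ : ℤ × ℤ) (k : ℤ) (b : Option (ℤ → ℤ)) : Option (ℤ → ℤ) :=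
  if 0 ≤ k then SwPos a1 a2 μ k.toNat b else SwNeg a1 a2 μ (-k).toNat b

/-- `b ∈ Z_ι(μ)` is extremal. -/
noncomputable def Extremal (μ : ℤ × ℤ) (b : ℤ → ℤ) : Prop :=
  ∀ js : List ℤ, (∀ j ∈ js, IsI j) →
    ∃ b', js.foldr (SiO a1 a2 μ) (some b) = some b' ∧
      ∀ i : ℤ, IsI i →
        (0 ≤ pairW (wtZ a1 a2 μ b') i → eZ a1 a2 μ i b' = none) ∧
        (pairW (wtZ a1 a2 μ b') i ≤ 0 → fZ a1 a2 μ i b' = none)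

/-- `φ(x) ≥ 0` for all `φ ∈ Ξ_ι[λ]`. -/
noncomputable def SigmaCond (x : ℤ → ℤ) : Prop :=
  (0 ≤ gammaR a1 a2 0 * (pseq a1 a2 k1 k2 0 : ℝ) + gammaR a1 a2 0 * (x 0 : ℝ) - (x 1 : ℝ)) ∧
  (0 ≤ gammaR a1 a2 1 * (pseq a1 a2 k1 k2 1 : ℝ) + (x 0 : ℝ) - gammaR a1 a2 1 * (x 1 : ℝ)) ∧
  (∀ k : ℤ, 1 ≤ k → 0 ≤ (pseq a1 a2 k1 k2 k : ℝ) - (x k : ℝ)) ∧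
  (∀ k : ℤ, 1 ≤ k → 0 ≤ gammaR a1 a2 k * (x k : ℝ) - (x (k + 1) : ℝ)) ∧
  (∀ k : ℤ, 1 ≤ k → 0 ≤ gammaR a1 a2 (k + 1) * (pseq a1 a2 k1 k2 (k + 1) : ℝ) -
      (pseq a1 a2 k1 k2 k : ℝ) + (x k : ℝ) - gammaR a1 a2 (k + 1) * (x (k + 1) : ℝ)) ∧
  (∀ k : ℤ, k ≤ 0 → 0 ≤ (pseq a1 a2 k1 k2 k : ℝ) + (x k : ℝ)) ∧
  (∀ k : ℤ, k ≤ 0 → 0 ≤ (x (k - 1) : ℝ) - gammaR a1 a2 k * (x k : ℝ)) ∧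
  (∀ k : ℤ, k ≤ 0 → 0 ≤ gammaR a1 a2 (k - 1) * (pseq a1 a2 k1 k2 (k - 1) : ℝ) -
      (pseq a1 a2 k1 k2 k : ℝ) + gammaR a1 a2 (k - 1) * (x (k - 1) : ℝ) - (x k : ℝ))

/-- membership in `Σ_ι[λ]`. -/
noncomputable def SigmaMem (x : ℤ → ℤ) : Prop :=
  ZMem x ∧ SigmaCond a1 a2 k1 k2 x

/-- membership in `Σ'_ι[λ]`. -/
noncomputable def SigmaPrimeMem (x : ℤ → ℤ) : Prop :=
  SigmaMem a1 a2 k1 k2 x ∧ (∀ k : ℤ, k ≤ 0 → x k = 0) ∧ XPlusMem a1 a2 (posPart x)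

/-- evaluation of an affine function `φ = (c, (φ_l)_l)` at `x`. -/
noncomputable def evalAff (φ : ℝ × (ℤ → ℝ)) (x : ℤ → ℤ) : ℝ :=
  φ.1 + ∑ᶠ l : ℤ, φ.2 l * (x l : ℝ)

/-- `a_{i_k}`. -/
def aIdx (k : ℤ) : ℤ := if k % 2 = 1 then a1 else a2

/-- the affine function `b̄_k`. -/
noncomputable def bbar (lam : ℤ × ℤ) (k : ℤ) : ℝ × (ℤ → ℝ) :=
  ((if k = -1 ∨ k = 0 then -(pairW lam (idx k) : ℝ) else 0),
    fun l => (if l = k then (1 : ℝ) else 0) + (if l = k + 1 then -(aIdx a1 a2 k : ℝ) else 0) +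
      (if l = k + 2 then (1 : ℝ) else 0))

/-- the operator `S̄_k` on affine functions. -/
noncomputable def SbarOp (lam : ℤ × ℤ) (k : ℤ) (φ : ℝ × (ℤ → ℝ)) : ℝ × (ℤ → ℝ) :=
  let b := if 0 ≤ φ.2 k then bbar a1 a2 lam (k + 2) else bbar a1 a2 lam (k - 2)
  (φ.1 - φ.2 k * b.1, fun l => φ.2 l - φ.2 k * b.2 l)

end HypCrystal

namespace HypCrystal

variable {a1 a2 : ℤ}

lemma idx_eq_iff (k n : ℤ) : idx k = idx n ↔ k % 2 = n % 2 := by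
  unfold idx; split_ifs <;> simp <;> omega

lemma pairJK_of_eq {j k : ℤ} (h : j % 2 = k % 2) : pairJK a1 a2 j k = 2 := by
  simp [pairJK, h]

lemma pairJK_of_ne {j k : ℤ} (h : j % 2 ≠ k % 2) : pairJK a1 a2 j k = -aIdx a1 a2 k := by
  simp only [pairJK, aIdx, h, if_false]; split_ifs <;> rfl

lemma pairW_alphaOf (j k : ℤ) : pairW (alphaOf a1 a2 j) (idx k) = pairJK a1 a2 j k := by
  unfold pairW alphaOf pairJK idx
  split_ifs <;> simp_all <;> omega

lemma alphaOf_congr {j k : ℤ} (h : j % 2 = k % 2) : alphaOf a1 a2 j = alphaOf a1 a2 k := by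
  simp [alphaOf, h]

/-! ### Single-coordinate updates -/

lemma finite_support_update {b : ℤ → ℤ} (hb : b.support.Finite) (K c : ℤ) :
    (update b K c).support.Finite := by
  refine (hb.insert K).subset fun j hj => ?_
  by_cases h : j = K
  · simp [h]
  · right
    simpa [update_of_ne h] using hj

lemma finite_support_mul {b : ℤ → ℤ} (hb : b.support.Finite) (g : ℤ → ℤ) :
    (support fun j => g j * b j).Finite :=
  hb.subset fun _ hj => right_ne_zero_of_mul hj

lemma finsum_mul_update {b : ℤ → ℤ} (hb : b.support.Finite) (g : ℤ → ℤ) (K c : ℤ) :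
    ∑ᶠ j, g j * update b K (b K + c) j = ∑ᶠ j, g j * b j + g K * c := by
  have h : ∀ j, g j * update b K (b K + c) j = g j * b j + (if j = K then g K * c else 0) := by
    intro j
    by_cases h : j = K
    · subst h; simp; ring
    · simp [h]
  have hs : (support fun j => if j = K then g K * c else 0).Finite :=
    (Set.finite_singleton K).subset fun j hj => by
      by_contra h
      exact hj (if_neg h)
  rw [finsum_congr h, finsum_add_distrib (finite_support_mul hb g) hs,
    finsum_eq_single (fun j => if j = K then g K * c else 0) K fun j hj => if_neg hj]
  simp

lemma sigmaP_eq (b : ℤ → ℤ) (k : ℤ) :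
    sigmaP a1 a2 b k = b k + ∑ᶠ j, (if k < j then pairJK a1 a2 j k else 0) * b j := by
  simp only [sigmaP, ite_mul, zero_mul]

lemma sigmaP_update {b : ℤ → ℤ} (hb : b.support.Finite) (K c k : ℤ) :
    sigmaP a1 a2 (update b K (b K + c)) k = sigmaP a1 a2 b k + (if k = K then c else 0) +
      (if k < K then pairJK a1 a2 K k * c else 0) := by
  rw [sigmaP_eq, sigmaP_eq, finsum_mul_update hb, ite_mul, zero_mul]
  by_cases h : k = K
  · subst h; simp; ring
  · simp [h]; ring

lemma wtOf_eq (b : ℤ → ℤ) : wtOf a1 a2 b =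
    (-∑ᶠ j, (alphaOf a1 a2 j).1 * b j, -∑ᶠ j, (alphaOf a1 a2 j).2 * b j) := by
  simp only [wtOf, mul_comm]

lemma wtOf_update {b : ℤ → ℤ} (hb : b.support.Finite) (K c : ℤ) :
    wtOf a1 a2 (update b K (b K + c)) = wtOf a1 a2 b - c • alphaOf a1 a2 K := by
  rw [wtOf_eq, wtOf_eq, finsum_mul_update hb, finsum_mul_update hb]
  ext <;> simp <;> ring

lemma pairW_neg_sum (b : ℤ → ℤ) (k : ℤ) :
    pairW (wtOf a1 a2 b) (idx k) = -∑ᶠ j, pairJK a1 a2 j k * b j := by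
  rw [wtOf_eq]
  simp only [← pairW_alphaOf, pairW]
  split_ifs <;> rfl

lemma pairW_add (u v : ℤ × ℤ) (i : ℤ) : pairW (u + v) i = pairW u i + pairW v i := by
  unfold pairW; split_ifs <;> rfl

lemma sigmaZ_eq {b : ℤ → ℤ} (hb : b.support.Finite) (μ : ℤ × ℤ) (k : ℤ) :
    sigmaZ a1 a2 μ b k = sigmaP a1 a2 b k - if 1 ≤ k then 0 else pairW μ (idx k) := by
  unfold sigmaZ
  split_ifs with hk
  · simp
  · have hM : sigmaM a1 a2 b k =
        -(b k) - ∑ᶠ j, (if j < k then pairJK a1 a2 j k else 0) * b j := by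
      simp only [sigmaM, ite_mul, zero_mul]
    have hdiag : ∑ᶠ j, (if j = k then pairJK a1 a2 j k else 0) * b j = 2 * b k := by
      rw [finsum_eq_single _ k fun j hj => by simp [hj]]
      simp [pairJK]
    have hsum : ∑ᶠ j, pairJK a1 a2 j k * b j =
        ∑ᶠ j, (if j < k then pairJK a1 a2 j k else 0) * b j +
        ∑ᶠ j, (if j = k then pairJK a1 a2 j k else 0) * b j +
        ∑ᶠ j, (if k < j then pairJK a1 a2 j k else 0) * b j := by
      rw [← finsum_add_distrib (finite_support_mul hb _) (finite_support_mul hb _),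
        ← finsum_add_distrib]
      · refine finsum_congr fun j => ?_
        rcases lt_trichotomy j k with h | h | h
        · simp [h, h.ne, h.not_gt]
        · simp [h]
        · simp [h, h.ne', h.not_gt]
      · simp only [← add_mul]
        exact finite_support_mul hb _
      · exact finite_support_mul hb _
    rw [wtZ, pairW_add, pairW_neg_sum, hM, sigmaP_eq, hsum, hdiag]
    ring

lemma sigmaZ_update {b : ℤ → ℤ} (hb : b.support.Finite) (μ : ℤ × ℤ) (K c k : ℤ) :
    sigmaZ a1 a2 μ (update b K (b K + c)) k = sigmaZ a1 a2 μ b k + (if k = K then c else 0) +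
      (if k < K then pairJK a1 a2 K k * c else 0) := by
  rw [sigmaZ_eq hb, sigmaZ_eq (finite_support_update hb _ _), sigmaP_update hb]
  ring

/-! ### Behaviour of `σ` far out -/

lemma exists_bound {b : ℤ → ℤ} (hb : b.support.Finite) :
    ∃ N : ℤ, 0 ≤ N ∧ (∀ k, N < k → b k = 0) ∧ ∀ k, k < -N → b k = 0 := by
  obtain ⟨u, hu⟩ := hb.bddAbove
  obtain ⟨l, hl⟩ := hb.bddBelow
  refine ⟨max 0 (max u (-l)), by simp, fun k hk => ?_, fun k hk => ?_⟩
  · by_contra h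
    have := hu (show k ∈ b.support from h)
    omega
  · by_contra h
    have := hl (show k ∈ b.support from h)
    omega

lemma sigmaP_congr {b b' : ℤ → ℤ} {k : ℤ} (h : ∀ j, k ≤ j → b j = b' j) :
    sigmaP a1 a2 b k = sigmaP a1 a2 b' k := by
  unfold sigmaP
  rw [h k le_rfl]
  congr 1
  refine finsum_congr fun j => ?_
  split_ifs with hj
  · rw [h j hj.le]
  · rfl

lemma sigmaP_zero (k : ℤ) : sigmaP a1 a2 (fun _ => 0) k = 0 := by
  simp [sigmaP]

lemma sigmaP_eq_zero {b : ℤ → ℤ} {k : ℤ} (h : ∀ j, k ≤ j → b j = 0) : sigmaP a1 a2 b k = 0 :=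
  (sigmaP_congr (b' := fun _ => 0) h).trans (sigmaP_zero k)

lemma sigmaZ_of_low {b : ℤ → ℤ} (μ : ℤ × ℤ) {k : ℤ} (hk : k ≤ 0) (h : ∀ j, j ≤ k → b j = 0) :
    sigmaZ a1 a2 μ b k = -pairW (wtZ a1 a2 μ b) (idx k) := by
  have hM : sigmaM a1 a2 b k = 0 := by
    unfold sigmaM
    rw [h k le_rfl, finsum_eq_zero_of_forall_eq_zero]
    · simp
    · intro j
      split_ifs with hj
      · rw [h j hj.le, mul_zero]
      · rfl
  rw [sigmaZ, if_neg (by omega), hM, zero_sub]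

lemma sigmaZ_of_pos {b : ℤ → ℤ} (μ : ℤ × ℤ) {k : ℤ} (hk : 1 ≤ k) :
    sigmaZ a1 a2 μ b k = sigmaP a1 a2 b k := if_pos hk

lemma bddAbove_sigmaZ {b : ℤ → ℤ} (hb : b.support.Finite) (μ : ℤ × ℤ) (i : ℤ) :
    BddAbove {s : ℤ | ∃ k : ℤ, idx k = i ∧ sigmaZ a1 a2 μ b k = s} := by
  obtain ⟨N, hN, hhi, hlo⟩ := exists_bound hb
  refine (((Set.finite_Icc (-N - 1) (N + 1)).image (sigmaZ a1 a2 μ b)).union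
    (Set.toFinite {0, -pairW (wtZ a1 a2 μ b) i})).bddAbove.mono ?_
  rintro s ⟨k, hk, rfl⟩
  by_cases h1 : N < k
  · right; left
    rw [sigmaZ_of_pos μ (by omega)]
    exact sigmaP_eq_zero fun j hj => hhi j (by omega)
  by_cases h2 : k < -N
  · right; right
    rw [sigmaZ_of_low μ (by omega) fun j hj => hlo j (by omega), hk]
    rfl
  · left
    exact ⟨k, ⟨by omega, by omega⟩, rfl⟩

lemma sigmaZ_le_of_fZ_eq_none {b : ℤ → ℤ} (hb : b.support.Finite) {μ : ℤ × ℤ} {i : ℤ}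
    (h : fZ a1 a2 μ i b = none) {k : ℤ} (hk : idx k = i) :
    sigmaZ a1 a2 μ b k ≤ -pairW (wtZ a1 a2 μ b) i := by
  have h1 : sigmaZ a1 a2 μ b k ≤ epsZ a1 a2 μ b i :=
    le_csSup (bddAbove_sigmaZ hb μ i) ⟨k, hk, rfl⟩
  have h2 : ¬ 0 < phiZ a1 a2 μ b i := fun hp => by simp [fZ, hp] at h
  unfold phiZ at h2
  omega

/-! ### Locating the coordinate changed by a crystal operator -/

lemma eZ_eq_some {b : ℤ → ℤ} {μ : ℤ × ℤ} {K : ℤ}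
    (hpos : 0 < sigmaZ a1 a2 μ b K)
    (hle : ∀ k, k % 2 = K % 2 → sigmaZ a1 a2 μ b k ≤ sigmaZ a1 a2 μ b K)
    (hlt : ∀ k, k % 2 = K % 2 → K < k → sigmaZ a1 a2 μ b k < sigmaZ a1 a2 μ b K) :
    eZ a1 a2 μ (idx K) b = some (update b K (b K + -1)) := by
  have heps : epsZ a1 a2 μ b (idx K) = sigmaZ a1 a2 μ b K := by
    refine IsGreatest.csSup_eq ⟨⟨K, rfl, rfl⟩, ?_⟩
    rintro s ⟨k, hk, rfl⟩
    exact hle k ((idx_eq_iff k K).1 hk)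
  have hK : kmaxZ a1 a2 μ b (idx K) = K := by
    refine IsGreatest.csSup_eq ⟨⟨rfl, heps.symm⟩, ?_⟩
    rintro k ⟨hk, hs⟩
    by_contra hlt'
    have := hlt k ((idx_eq_iff k K).1 hk) (not_le.1 hlt')
    omega
  rw [eZ, if_pos (heps ▸ hpos), hK]
  rfl

lemma fP_eq {b : ℤ → ℤ} {K : ℤ} (hK1 : 1 ≤ K)
    (hle : ∀ k, 1 ≤ k → k % 2 = K % 2 → sigmaP a1 a2 b k ≤ sigmaP a1 a2 b K)
    (hlt : ∀ k, 1 ≤ k → k % 2 = K % 2 → k < K → sigmaP a1 a2 b k < sigmaP a1 a2 b K) :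
    fP a1 a2 (idx K) b = update b K (b K + 1) := by
  have heps : epsP a1 a2 b (idx K) = sigmaP a1 a2 b K := by
    refine IsGreatest.csSup_eq ⟨⟨K, hK1, rfl, rfl⟩, ?_⟩
    rintro s ⟨k, hk1, hk, rfl⟩
    exact hle k hk1 ((idx_eq_iff k K).1 hk)
  have hK : kminP a1 a2 b (idx K) = K := by
    refine IsLeast.csInf_eq ⟨⟨hK1, rfl, heps.symm⟩, ?_⟩
    rintro k ⟨hk1, hk, hs⟩
    by_contra hlt'
    have := hlt k hk1 ((idx_eq_iff k K).1 hk) (not_le.1 hlt')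
    omega
  rw [fP, hK]

/-! ### Iterating `ẽ` on `Z_ι(μ)` down to `ε = 0` -/

/-- `b'` is obtained from `b` by removing, at positions of the colour of `n`, amounts whose tail sums
are `R`, where `R k` is the maximum of `0` and of `σ_l(b)` over `l ≥ k` of that colour. -/
structure DrainStep (a1 a2 : ℤ) (μ : ℤ × ℤ) (n P : ℤ) (b b' R : ℤ → ℤ) : Prop where
  finite : b'.support.Finite
  tail_eq : ∀ k, k % 2 = n % 2 → R k = max (sigmaZ a1 a2 μ b k) (R (k + 2))
  tail_le : ∀ k, k % 2 = n % 2 → R k ≤ P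
  tail_eventually : ∃ N, ∀ k, N < k → R k = 0
  coord_same : ∀ k, k % 2 = n % 2 → b' k = b k - (R k - R (k + 2))
  coord_other : ∀ k, k % 2 ≠ n % 2 → b' k = b k
  sigma_same : ∀ k, k % 2 = n % 2 →
    sigmaZ a1 a2 μ b' k = sigmaZ a1 a2 μ b k - R k - R (k + 2)
  sigma_other : ∀ k, k % 2 ≠ n % 2 →
    sigmaZ a1 a2 μ b' k = sigmaZ a1 a2 μ b k + aIdx a1 a2 k * R (k + 1)

lemma le_of_step_two {R : ℤ → ℤ} {n : ℤ} (h : ∀ k, k % 2 = n % 2 → R (k + 2) ≤ R k) {j k : ℤ}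
    (hj : j % 2 = n % 2) (hk : k % 2 = n % 2) (hjk : j ≤ k) : R k ≤ R j := by
  obtain ⟨t, rfl⟩ : ∃ t : ℕ, k = j + 2 * t := ⟨((k - j) / 2).toNat, by omega⟩
  clear hk hjk
  induction t with
  | zero => simp
  | succ t ih =>
    refine le_trans ?_ ih
    rw [show j + 2 * ((t + 1 : ℕ) : ℤ) = j + 2 * t + 2 by push_cast; ring]
    exact h (j + 2 * t) (by omega)

lemma exists_drainStep (μ : ℤ × ℤ) (n : ℤ) (P : ℕ) (b : ℤ → ℤ) (hb : b.support.Finite)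
    (hle : ∀ k, k % 2 = n % 2 → sigmaZ a1 a2 μ b k ≤ P)
    (hex : ∃ k, k % 2 = n % 2 ∧ sigmaZ a1 a2 μ b k = P) :
    ∃ b' R, eZiterO a1 a2 μ (idx n) P (some b) = some b' ∧ DrainStep a1 a2 μ n P b b' R := by
  induction P generalizing b with
  | zero =>
    refine ⟨b, fun _ => 0, rfl, hb, ?_, ?_, ⟨0, ?_⟩, ?_, ?_, ?_, ?_⟩ <;>
      intro k hk <;> simp
    simpa using hle k hk
  | succ P ih =>
    obtain ⟨N, hN, hhi, -⟩ := exists_bound hb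
    obtain ⟨K, ⟨hKc, hKs⟩, hKmax⟩ := Int.exists_greatest_of_bdd
      (P := fun k => k % 2 = n % 2 ∧ sigmaZ a1 a2 μ b k = (P + 1 : ℕ))
      ⟨N, fun k hk => by
        by_contra h
        have := hk.2
        rw [sigmaZ_of_pos μ (by omega), sigmaP_eq_zero fun j hj => hhi j (by omega)] at this
        omega⟩ hex
    have hKlt : ∀ k, k % 2 = n % 2 → K < k → sigmaZ a1 a2 μ b k < (P + 1 : ℕ) := by
      intro k hk hlt
      refine lt_of_le_of_ne (hle k hk) fun he => ?_
      have := hKmax k ⟨hk, he⟩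
      omega
    have he : eZ a1 a2 μ (idx n) b = some (update b K (b K + -1)) := by
      rw [← (idx_eq_iff K n).2 hKc]
      refine eZ_eq_some (by omega) ?_ ?_
      · intro k hk; rw [hKs]; exact hle k (hk.trans hKc)
      · intro k hk; rw [hKs]; exact hKlt k (hk.trans hKc)
    have hfin := finite_support_update hb K (b K + -1)
    have hsame : ∀ k, k % 2 = n % 2 → sigmaZ a1 a2 μ (update b K (b K + -1)) k =
        sigmaZ a1 a2 μ b k - (if k = K then 1 else 0) - (if k < K then 2 else 0) := by
      intro k hk
      rw [sigmaZ_update hb, pairJK_of_eq (hKc.trans hk.symm)]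
      split_ifs <;> omega
    have hother : ∀ k, k % 2 ≠ n % 2 → sigmaZ a1 a2 μ (update b K (b K + -1)) k =
        sigmaZ a1 a2 μ b k + aIdx a1 a2 k * (if k < K then 1 else 0) := by
      intro k hk
      rw [sigmaZ_update hb, pairJK_of_ne (by omega), if_neg (by rintro rfl; exact hk hKc)]
      split_ifs <;> ring
    obtain ⟨b', R, hb', h⟩ := ih (update b K (b K + -1)) hfin
      (by
        intro k hk
        rw [hsame k hk]
        have h1 := hle k hk
        have h2 := hKlt k hk
        split_ifs <;> push_cast at * <;> omega)
      ⟨K, hKc, by rw [hsame K hKc, hKs]; simp⟩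
    have hanti : ∀ k, k % 2 = n % 2 → R (k + 2) ≤ R k := fun k hk => by
      rw [h.tail_eq k hk]; exact le_max_right _ _
    have hRK : R K = P := by
      refine le_antisymm (h.tail_le K hKc) ?_
      rw [h.tail_eq K hKc, hsame K hKc, hKs]
      simp
    have hRlow : ∀ k, k % 2 = n % 2 → k ≤ K → R k = P := fun k hk hkK =>
      le_antisymm (h.tail_le k hk) (hRK ▸ le_of_step_two hanti hk hKc hkK)
    have hcase : ∀ k, k % 2 = n % 2 → k < K → k + 2 ≤ K := by omega
    refine ⟨b', fun k => if k ≤ K then P + 1 else R k, ?_, h.finite, ?_, ?_, ?_, ?_, ?_, ?_, ?_⟩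
    · rw [eZiterO, Function.iterate_succ_apply, Option.bind_some, he]
      exact hb'
    · intro k hk
      have h1 := h.tail_eq k hk
      have h2 := hsame k hk
      have h3 := hle k hk
      have h4 := hcase k hk
      have h5 := h.tail_le (k + 2) (by omega)
      push_cast at h3 hKs
      rcases lt_trichotomy k K with hlt | rfl | hgt
      · have := h4 hlt
        simp only [hlt.le, this, if_true]; omega
      · simp; omega
      · simp only [hgt.not_gt, hgt.ne', if_false] at h2
        rw [if_neg (by omega), if_neg (by omega)]
        omega
    · intro k hk
      have := h.tail_le k hk
      split_ifs <;> push_cast <;> omega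
    · obtain ⟨M, hM⟩ := h.tail_eventually
      exact ⟨max M K, fun k hk => by simp [not_le.2 (lt_of_le_of_lt (le_max_right M K) hk),
        hM k (lt_of_le_of_lt (le_max_left M K) hk)]⟩
    · intro k hk
      have h1 := h.coord_same k hk
      have h4 := hcase k hk
      rcases lt_trichotomy k K with hlt | rfl | hgt
      · have h5 := h4 hlt
        rw [update_of_ne hlt.ne, hRlow k hk hlt.le, hRlow (k + 2) (by omega) h5] at h1
        simp only [hlt.le, h5, if_true]; omega
      · rw [update_self, hRK] at h1
        simp; omega
      · rw [update_of_ne hgt.ne'] at h1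
        rw [if_neg (by omega), if_neg (by omega)]
        omega
    · intro k hk
      rw [h.coord_other k hk, update_of_ne]
      rintro rfl
      exact hk hKc
    · intro k hk
      have h1 := h.sigma_same k hk
      have h2 := hsame k hk
      have h4 := hcase k hk
      rcases lt_trichotomy k K with hlt | rfl | hgt
      · have h5 := h4 hlt
        simp only [hlt, hlt.ne, if_true, if_false] at h2
        rw [hRlow k hk hlt.le, hRlow (k + 2) (by omega) h5] at h1
        simp only [hlt.le, h5, if_true]; omega
      · rw [hRK] at h1
        simp at h2 ⊢; omega
      · simp only [hgt.not_gt, hgt.ne', if_false] at h2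
        rw [if_neg (by omega), if_neg (by omega)]
        omega
    · intro k hk
      rw [h.sigma_other k hk, hother k hk]
      by_cases hlt : k < K
      · rw [if_pos hlt, if_pos (by omega), hRlow (k + 1) (by omega) (by omega)]
        ring
      · rw [if_neg hlt, if_neg (by omega)]
        ring

/-! ### Iterating `f̃` on `ℤ^{+∞}` -/

/-- `W'` is obtained from `W` by adding `m` units, with tail sums `D`, to the positions `≥ 1` of the
colour of `n`, in the way prescribed by `f̃^m` when `ε(W) = e`. -/
structure FillStep (a1 a2 n m e : ℤ) (W W' D : ℤ → ℤ) : Prop where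
  finite : W'.support.Finite
  wt : wtOf a1 a2 W' = wtOf a1 a2 W - m • alphaOf a1 a2 n
  nonneg : ∀ k, 1 ≤ k → k % 2 = n % 2 → 0 ≤ D k
  tail_start : ∀ k, 1 ≤ k → k ≤ 2 → k % 2 = n % 2 → D k = m
  tail_eq : ∀ k, 1 ≤ k → k % 2 = n % 2 → D (k + 2) = min (D k) (e - sigmaP a1 a2 W k)
  coord_low : ∀ k, k ≤ 0 → W' k = W k
  coord_same : ∀ k, 1 ≤ k → k % 2 = n % 2 → W' k = W k + (D k - D (k + 2))
  coord_other : ∀ k, k % 2 ≠ n % 2 → W' k = W k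
  sigma_same : ∀ k, 1 ≤ k → k % 2 = n % 2 →
    sigmaP a1 a2 W' k = sigmaP a1 a2 W k + D k + D (k + 2)
  sigma_other : ∀ k, 1 ≤ k → k % 2 ≠ n % 2 →
    sigmaP a1 a2 W' k = sigmaP a1 a2 W k - aIdx a1 a2 k * D (k + 1)

lemma FillStep.antitone {n m e : ℤ} {W W' D : ℤ → ℤ} (h : FillStep a1 a2 n m e W W' D) (k : ℤ)
    (hk1 : 1 ≤ k) (hk : k % 2 = n % 2) : D (k + 2) ≤ D k := by
  rw [h.tail_eq k hk1 hk]; exact min_le_left _ _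

lemma FillStep.le_of_le {n m e : ℤ} {W W' D : ℤ → ℤ} (h : FillStep a1 a2 n m e W W' D) {j k : ℤ}
    (hj1 : 1 ≤ j) (hj : j % 2 = n % 2) (hk : k % 2 = n % 2) (hjk : j ≤ k) : D k ≤ D j := by
  have := le_of_step_two (R := fun k => if 1 ≤ k then D k else max (D 1) (D 2)) (n := n) ?_
    hj hk hjk
  · simpa [hj1, hj1.trans hjk] using this
  · intro k hk
    by_cases h1 : 1 ≤ k
    · simpa [h1, show 1 ≤ k + 2 by omega] using h.antitone k h1 hk
    · by_cases h2 : 1 ≤ k + 2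
      · rcases (by omega : k + 2 = 1 ∨ k + 2 = 2) with h3 | h3 <;> simp [h1, h3]
      · simp [h1, h2]

lemma exists_fillStep (n : ℤ) (m : ℕ) (e : ℤ) (W : ℤ → ℤ) (hW : W.support.Finite)
    (hle : ∀ k, 1 ≤ k → k % 2 = n % 2 → sigmaP a1 a2 W k ≤ e)
    (hex : ∃ k, 1 ≤ k ∧ k % 2 = n % 2 ∧ sigmaP a1 a2 W k = e) :
    ∃ D, FillStep a1 a2 n m e W (fPiter a1 a2 (idx n) m W) D := by
  induction m generalizing W e with
  | zero =>
    refine ⟨fun _ => 0, hW, ?_, ?_, ?_, ?_, ?_, ?_, ?_, ?_, ?_⟩ <;> simp [fPiter]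
    exact hle
  | succ m ih =>
    obtain ⟨K, ⟨hK1, hKc, hKs⟩, hKmin⟩ := Int.exists_least_of_bdd
      (P := fun k => 1 ≤ k ∧ k % 2 = n % 2 ∧ sigmaP a1 a2 W k = e) ⟨1, fun k hk => hk.1⟩ hex
    have hKlt : ∀ k, 1 ≤ k → k % 2 = n % 2 → k < K → sigmaP a1 a2 W k < e := by
      intro k hk1 hk hlt
      refine lt_of_le_of_ne (hle k hk1 hk) fun he => ?_
      have := hKmin k ⟨hk1, hk, he⟩
      omega
    have hf : fP a1 a2 (idx n) W = update W K (W K + 1) := by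
      rw [← (idx_eq_iff K n).2 hKc]
      refine fP_eq hK1 ?_ ?_
      · intro k hk1 hk; rw [hKs]; exact hle k hk1 (hk.trans hKc)
      · intro k hk1 hk; rw [hKs]; exact hKlt k hk1 (hk.trans hKc)
    have hsame : ∀ k, k % 2 = n % 2 → sigmaP a1 a2 (update W K (W K + 1)) k =
        sigmaP a1 a2 W k + (if k = K then 1 else 0) + (if k < K then 2 else 0) := by
      intro k hk
      rw [sigmaP_update hW, pairJK_of_eq (hKc.trans hk.symm), mul_one]
    have hother : ∀ k, k % 2 ≠ n % 2 → sigmaP a1 a2 (update W K (W K + 1)) k =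
        sigmaP a1 a2 W k - aIdx a1 a2 k * (if k < K then 1 else 0) := by
      intro k hk
      rw [sigmaP_update hW, pairJK_of_ne (by omega), if_neg (by rintro rfl; exact hk hKc)]
      split_ifs <;> ring
    obtain ⟨D, h⟩ := ih (e + 1) (update W K (W K + 1)) (finite_support_update hW _ _)
      (by
        intro k hk1 hk
        rw [hsame k hk]
        have h1 := hle k hk1 hk
        have h2 := hKlt k hk1 hk
        split_ifs <;> omega)
      ⟨K, hK1, hKc, by rw [hsame K hKc, hKs]; simp⟩
    have hiter : fPiter a1 a2 (idx n) (m + 1) W =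
        fPiter a1 a2 (idx n) m (update W K (W K + 1)) := by
      rw [fPiter, Function.iterate_succ_apply, hf]; rfl
    rw [hiter]
    have hDK : D (K + 2) = 0 := by
      rw [h.tail_eq K hK1 hKc, hsame K hKc, hKs]
      have := h.nonneg K hK1 hKc
      simp; omega
    have hDhigh : ∀ k, k % 2 = n % 2 → K < k → D k = 0 := fun k hk hlt =>
      le_antisymm (hDK ▸ h.le_of_le (by omega) (by omega) hk (by omega))
        (h.nonneg k (by omega) hk)
    have hcase : ∀ k, k % 2 = n % 2 → k < K → k + 2 ≤ K := by omega
    refine ⟨fun k => D k + if k ≤ K then 1 else 0, h.finite, ?_, ?_, ?_, ?_, ?_, ?_, ?_, ?_, ?_⟩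
    · rw [h.wt, wtOf_update hW, alphaOf_congr hKc]
      push_cast
      rw [add_smul]
      abel
    · intro k hk1 hk
      have := h.nonneg k hk1 hk
      split_ifs <;> omega
    · intro k hk1 hk2 hk
      have := h.tail_start k hk1 hk2 hk
      simp only [show k ≤ K by omega, if_true, this]
      push_cast; rfl
    · intro k hk1 hk
      have h1 := h.tail_eq k hk1 hk
      have h2 := hsame k hk
      have h3 := hle k hk1 hk
      rcases lt_trichotomy k K with hlt | rfl | hgt
      · simp only [hlt, hlt.ne, if_true, if_false] at h2
        simp only [hlt.le, hcase k hk hlt, if_true]; omega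
      · have := h.nonneg k hk1 hk
        simp only [hDK, le_refl, if_true]
        rw [if_neg (by omega)]
        omega
      · simp only [hgt.not_ge, if_false, hDhigh k hk hgt, hDhigh (k + 2) (by omega) (by omega)]
        rw [if_neg (by omega)]
        omega
    · intro k hk
      rw [h.coord_low k hk, update_of_ne (by omega)]
    · intro k hk1 hk
      have h1 := h.coord_same k hk1 hk
      rcases lt_trichotomy k K with hlt | rfl | hgt
      · rw [update_of_ne hlt.ne] at h1
        simp only [hlt.le, hcase k hk hlt, if_true]; omega
      · rw [update_self] at h1
        simp; omega
      · rw [update_of_ne hgt.ne'] at h1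
        rw [if_neg (by omega), if_neg (by omega)]
        omega
    · intro k hk
      rw [h.coord_other k hk, update_of_ne]
      rintro rfl
      exact hk hKc
    · intro k hk1 hk
      have h1 := h.sigma_same k hk1 hk
      have h2 := hsame k hk
      rcases lt_trichotomy k K with hlt | rfl | hgt
      · simp only [hlt, hlt.ne, if_true, if_false] at h2
        simp only [hlt.le, hcase k hk hlt, if_true]; omega
      · simp at h2 ⊢; omega
      · simp only [hgt.not_gt, hgt.ne', if_false] at h2
        rw [if_neg (by omega), if_neg (by omega)]
        omega
    · intro k hk1 hk
      rw [h.sigma_other k hk1 hk, hother k hk]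
      by_cases hlt : k < K
      · rw [if_pos hlt, if_pos (by omega)]; ring
      · rw [if_neg hlt, if_neg (by omega)]; ring

/-! ### Positivity of the sequences `c_j` and `p_m` -/

lemma pos_of_recurrence {u a : ℕ → ℤ} (ha : ∀ j, 1 ≤ a j) (haa : ∀ j, 4 ≤ a j * a (j + 1))
    (hu : ∀ j, u (j + 2) = a j * u (j + 1) - u j) (h0 : 2 * u 0 ≤ a 0 * u 1) (h1 : 0 < u 1)
    (j : ℕ) : 0 < u (j + 1) := by
  suffices h : 2 * u j ≤ a j * u (j + 1) ∧ 0 < u (j + 1) from h.2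
  induction j with
  | zero => exact ⟨h0, h1⟩
  | succ j ih =>
    obtain ⟨ih1, ih2⟩ := ih
    have h2 : a j * u (j + 1) ≤ 2 * u (j + 2) := by rw [hu j]; linarith
    have h3 : 0 < a j * u (j + 1) := mul_pos (by linarith [ha j]) ih2
    refine ⟨?_, by show 0 < u (j + 2); linarith⟩
    show 2 * u (j + 1) ≤ a (j + 1) * u (j + 2)
    nlinarith [haa j, ha (j + 1),
      mul_le_mul_of_nonneg_left h2 (by linarith [ha (j + 1)] : 0 ≤ a (j + 1))]

lemma aIdx_pos (ha1 : 1 ≤ a1) (ha2 : 1 ≤ a2) (k : ℤ) : 1 ≤ aIdx a1 a2 k := by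
  unfold aIdx; split_ifs <;> assumption

lemma aIdx_congr {j k : ℤ} (h : j % 2 = k % 2) : aIdx a1 a2 j = aIdx a1 a2 k := by
  simp [aIdx, h]

lemma aIdx_mul_aIdx_succ (k : ℤ) : aIdx a1 a2 k * aIdx a1 a2 (k + 1) = a1 * a2 := by
  rcases Int.emod_two_eq_zero_or_one k with h | h
  · simp [aIdx, h, show (k + 1) % 2 = 1 by omega, mul_comm]
  · simp [aIdx, h, show (k + 1) % 2 = 0 by omega]

lemma cseq_add_two (j : ℕ) :
    cseq a1 a2 (j + 2) = aIdx a1 a2 (j + 1) * cseq a1 a2 (j + 1) - cseq a1 a2 j := by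
  rw [cseq]
  congr 2
  unfold aIdx
  split_ifs <;> first | rfl | omega

lemma ppos_add_two (k1 k2 : ℤ) (m : ℕ) :
    ppos a1 a2 k1 k2 (m + 2) = aIdx a1 a2 m * ppos a1 a2 k1 k2 (m + 1) - ppos a1 a2 k1 k2 m := by
  rw [ppos]
  congr 2
  unfold aIdx
  split_ifs <;> first | rfl | omega

lemma cseq_pos (ha1 : 1 ≤ a1) (ha2 : 1 ≤ a2) (ha : 4 < a1 * a2) (j : ℕ) :
    0 < cseq a1 a2 (j + 1) := by
  refine pos_of_recurrence (a := fun j => aIdx a1 a2 (j + 1)) (fun j => aIdx_pos ha1 ha2 _)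
    (fun j => ?_) cseq_add_two ?_ ?_ j
  · have := aIdx_mul_aIdx_succ (a1 := a1) (a2 := a2) (j + 1)
    push_cast
    rw [this]
    exact ha.le
  · simp [cseq, aIdx]; omega
  · simp [cseq]

lemma cseq_nonneg (ha1 : 1 ≤ a1) (ha2 : 1 ≤ a2) (ha : 4 < a1 * a2) (j : ℕ) :
    0 ≤ cseq a1 a2 j := by
  cases j with
  | zero => simp [cseq]
  | succ j => exact (cseq_pos ha1 ha2 ha j).le

lemma ppos_pos (ha1 : 1 ≤ a1) (ha2 : 1 ≤ a2) (ha : 4 < a1 * a2)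
    {k1 k2 : ℤ} (hk1 : 0 < k1) (hk2 : 0 < k2)
    (hreg : 2 ≤ a1 → 2 ≤ a2 →
      (k2 ≤ k1 ∧ k1 < (a1 - 1) * k2) ∨ (k1 < k2 ∧ k2 ≤ (a2 - 1) * k1))
    (hdeg1 : a1 = 1 → 2 * k1 ≤ k2 ∧ k2 ≤ (a2 - 2) * k1)
    (hdeg2 : a2 = 1 → 2 * k2 ≤ k1 ∧ k1 ≤ (a1 - 2) * k2) (m : ℕ) :
    0 < ppos a1 a2 k1 k2 m := by
  have from_zero : 2 * k2 ≤ a2 * k1 → ∀ m, 0 < ppos a1 a2 k1 k2 (m + 1) := by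
    intro h m
    refine pos_of_recurrence (a := fun j => aIdx a1 a2 j) (fun j => aIdx_pos ha1 ha2 _)
      (fun j => ?_) (ppos_add_two k1 k2) ?_ ?_ m
    · push_cast
      rw [aIdx_mul_aIdx_succ]
      exact ha.le
    · simpa [ppos, aIdx] using h
    · simpa [ppos] using hk1
  have from_one : 2 * k1 ≤ a1 * (a2 * k1 - k2) → 0 < a2 * k1 - k2 →
      ∀ m, 0 < ppos a1 a2 k1 k2 (m + 1) := by
    intro h h' m
    cases m with
    | zero => simpa [ppos] using hk1
    | succ m =>
      refine pos_of_recurrence (u := fun j => ppos a1 a2 k1 k2 (j + 1))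
        (a := fun j => aIdx a1 a2 (j + 1)) (fun j => aIdx_pos ha1 ha2 _)
        (fun j => ?_) (fun j => ?_) ?_ ?_ m
      · push_cast
        rw [aIdx_mul_aIdx_succ]
        exact ha.le
      · have := ppos_add_two (a1 := a1) (a2 := a2) k1 k2 (j + 1)
        push_cast at this
        exact this
      · simpa [ppos, aIdx] using h
      · simpa [ppos] using h'
  suffices h : ∀ m, 0 < ppos a1 a2 k1 k2 (m + 1) by
    cases m with
    | zero => simpa [ppos] using hk2
    | succ m => exact h m
  rcases eq_or_lt_of_le ha1 with h1 | h1
  · obtain ⟨h2, h3⟩ := hdeg1 h1.symm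
    refine from_one ?_ ?_
    · rw [← h1]; linarith
    · linarith
  rcases eq_or_lt_of_le ha2 with h2 | h2
  · obtain ⟨h3, -⟩ := hdeg2 h2.symm
    exact from_zero (by rw [← h2]; linarith)
  rcases hreg h1 h2 with ⟨h3, -⟩ | ⟨-, h3⟩
  · exact from_zero (by nlinarith)
  · have h4 : k1 ≤ a2 * k1 - k2 := by linarith
    exact from_one (by nlinarith) (by linarith)

/-! ### The `∗`-operation on `X+` as a sequence of fillings -/

lemma exists_states {x : ℤ → ℤ} (hx : ZPlusMem x) :
    ∃ (W : ℕ → ℤ → ℤ) (N : ℕ), starP a1 a2 x = W 0 ∧ (∀ k : ℤ, (N : ℤ) < k → x k = 0) ∧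
      (∀ n, N ≤ n → W n = fun _ => 0) ∧
      ∀ n : ℕ, W n = fPiter a1 a2 (idx (n + 1)) (x (n + 1)).toNat (W (n + 1)) := by
  set N := suppBoundP x with hN
  have hNx : ∀ k : ℤ, (N : ℤ) < k → x k = 0 := Nat.sInf_mem hx.2.2
  let V : ℕ → ℤ → ℤ := fun t => Nat.rec (fun _ => 0)
    (fun t z => fPiter a1 a2 (idx ((N : ℤ) - t)) (x ((N : ℤ) - t)).toNat z) t
  have hV : ∀ t : ℕ, V (t + 1) =
      fPiter a1 a2 (idx ((N : ℤ) - t)) (x ((N : ℤ) - t)).toNat (V t) := fun t => rfl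
  have hchain : ∀ n t : ℕ, n + t = N → starPChain a1 a2 x n (V t) = V N := by
    intro n
    induction n with
    | zero => intro t ht; rw [starPChain, ← ht, zero_add]
    | succ n ih =>
      intro t ht
      rw [starPChain, ← ih (t + 1) (by omega), hV, show (N : ℤ) - t = n + 1 by omega]
  refine ⟨fun n => V (N - n), N, hchain N 0 rfl, hNx, fun n hn => ?_, fun n => ?_⟩
  · show V (N - n) = _
    rw [Nat.sub_eq_zero_of_le hn]
    rfl
  · show V (N - n) = fPiter a1 a2 _ _ (V (N - (n + 1)))
    by_cases hn : n + 1 ≤ N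
    · rw [show N - n = N - (n + 1) + 1 by omega, hV,
        show (N : ℤ) - (N - (n + 1) : ℕ) = n + 1 by omega]
    · rw [hNx (n + 1) (by omega), show N - n = 0 by omega, show N - (n + 1) = 0 by omega]
      rfl

lemma fillStep_zero (n : ℤ) :
    FillStep a1 a2 n 0 0 (fun _ => 0) (fun _ => 0) (fun _ => 0) := by
  constructor <;> simp [sigmaP_zero, Function.support_fun_zero]

lemma exists_fillStep_states (ha1 : 1 ≤ a1) (ha2 : 1 ≤ a2) (ha : 4 < a1 * a2) {x : ℤ → ℤ}
    (hx : XPlusMem a1 a2 x) {W : ℕ → ℤ → ℤ} {N : ℕ} (hN : ∀ k : ℤ, (N : ℤ) < k → x k = 0)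
    (hW0 : ∀ n, N ≤ n → W n = fun _ => 0)
    (hW : ∀ n : ℕ, W n = fPiter a1 a2 (idx (n + 1)) (x (n + 1)).toNat (W (n + 1))) (n : ℕ) :
    ∃ D, FillStep a1 a2 (n + 1) (x (n + 1)) 0 (W (n + 1)) (W n) D := by
  suffices h : ∀ t n : ℕ, N ≤ n + t →
      ∃ D D', FillStep a1 a2 (n + 1) (x (n + 1)) 0 (W (n + 1)) (W n) D ∧
        FillStep a1 a2 (n + 2) (x (n + 2)) 0 (W (n + 2)) (W (n + 1)) D' ∧
        ∀ k : ℤ, 1 ≤ k → k % 2 = ((n : ℤ) + 2) % 2 →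
          cseq a1 a2 n * D' k ≤ cseq a1 a2 (n + 1) * D (k + 1) by
    obtain ⟨D, -, hD, -⟩ := h N n (by omega)
    exact ⟨D, hD⟩
  intro t
  induction t with
  | zero =>
    intro n hn
    refine ⟨fun _ => 0, fun _ => 0, ?_, ?_, by simp⟩
    · rw [hW0 n (by omega), hW0 (n + 1) (by omega), hN (n + 1) (by omega)]
      exact fillStep_zero _
    · rw [hW0 (n + 1) (by omega), hW0 (n + 2) (by omega), hN (n + 2) (by omega)]
      exact fillStep_zero _
  | succ t ih =>
    intro n hn
    obtain ⟨D, D', hD, hD', hineq⟩ := ih (n + 1) (by omega)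
    push_cast at hD hD' hineq
    rw [add_assoc, one_add_one_eq_two] at hD
    have hc1 := cseq_pos ha1 ha2 ha n
    have hc0 := cseq_nonneg ha1 ha2 ha n
    have hxnn := hx.1.2.1
    have hcone : cseq a1 a2 n * x (n + 2) ≤ cseq a1 a2 (n + 1) * x (n + 1) := by
      have := hx.2 (n + 1) (by omega)
      rw [show ((n : ℤ) + 1).toNat = n + 1 by omega, show ((n : ℤ) + 1 - 1).toNat = n by omega,
        add_assoc, one_add_one_eq_two] at this
      linarith
    have hsig : ∀ k : ℤ, 1 ≤ k → k % 2 = ((n : ℤ) + 1) % 2 →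
        cseq a1 a2 (n + 1) * sigmaP a1 a2 (W (n + 1)) k ≤ -(cseq a1 a2 n * D (k + 1)) := by
      intro k hk1 hk
      have h1 := hD.sigma_other k hk1 (by omega)
      have h2 := hD'.sigma_same k hk1 (by omega)
      have h3 := hD'.tail_eq k hk1 (by omega)
      have h4 := hineq k hk1 (by omega)
      have h5 : sigmaP a1 a2 (W (n + 1)) k ≤ D' k - aIdx a1 a2 k * D (k + 1) := by
        have := min_le_right (D' k) (0 - sigmaP a1 a2 (W (n + 1 + 2)) k)
        linarith
      have h6 := mul_le_mul_of_nonneg_left h5 hc1.le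
      rw [cseq_add_two, ← aIdx_congr hk] at h4
      linarith
    have hle : ∀ k : ℤ, 1 ≤ k → k % 2 = ((n : ℤ) + 1) % 2 →
        sigmaP a1 a2 (W (n + 1)) k ≤ 0 := by
      intro k hk1 hk
      have h1 := hsig k hk1 hk
      have h2 := mul_nonneg hc0 (hD.nonneg (k + 1) (by omega) (by omega))
      by_contra h3
      have := mul_pos hc1 (not_le.1 h3)
      linarith
    have hex : ∃ k : ℤ, 1 ≤ k ∧ k % 2 = ((n : ℤ) + 1) % 2 ∧
        sigmaP a1 a2 (W (n + 1)) k = 0 := by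
      obtain ⟨M, hM, hhi, -⟩ := exists_bound hD.finite
      exact ⟨2 * M + n + 3, by omega, by omega,
        sigmaP_eq_zero fun j hj => hhi j (by omega)⟩
    obtain ⟨D₀, hD₀⟩ := exists_fillStep ((n : ℤ) + 1) (x (n + 1)).toNat 0 (W (n + 1))
      hD.finite hle hex
    rw [← hW n, Int.toNat_of_nonneg (hxnn _)] at hD₀
    refine ⟨D₀, D, hD₀, hD, fun k hk1 hk => ?_⟩
    have hDx : ∀ k : ℤ, 1 ≤ k → k % 2 = ((n : ℤ) + 2) % 2 → D k ≤ x (n + 2) := by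
      intro k hk1 hk
      by_cases h : k % 2 = 1
      · rw [← hD.tail_start 1 (by omega) (by omega) (by omega)]
        exact hD.le_of_le le_rfl (by omega) hk hk1
      · rw [← hD.tail_start 2 (by omega) (by omega) (by omega)]
        exact hD.le_of_le (by omega) (by omega) hk (by omega)
    have hstart : ∀ k : ℤ, 1 ≤ k → k % 2 = ((n : ℤ) + 2) % 2 →
        cseq a1 a2 n * D k ≤ cseq a1 a2 (n + 1) * x (n + 1) := fun k hk1 hk =>
      (mul_le_mul_of_nonneg_left (hDx k hk1 hk) hc0).trans hcone
    obtain ⟨r, rfl⟩ : ∃ r : ℕ, k = r + 1 := ⟨(k - 1).toNat, by omega⟩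
    induction r using Nat.strong_induction_on with
    | _ r ihr =>
      rcases Nat.eq_zero_or_pos r with rfl | hr
      · rw [hD₀.tail_start _ (by omega) (by simp) (by omega)]
        exact hstart _ hk1 hk
      · have h1 := hD₀.tail_eq r (by omega) (by omega)
        have h2 := hsig r (by omega) (by omega)
        rw [show (r : ℤ) + 1 + 1 = r + 2 by ring, h1, mul_min_of_nonneg _ _ hc1.le]
        refine le_min ?_ (by linarith)
        by_cases hr2 : r ≤ 2
        · rw [hD₀.tail_start r (by omega) (by omega) (by omega)]
          exact hstart _ hk1 hk
        · have h3 := ihr (r - 2) (by omega) (by omega) (by omega)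
          rw [show ((r - 2 : ℕ) : ℤ) + 1 = r - 1 by omega, sub_add_cancel] at h3
          refine le_trans (mul_le_mul_of_nonneg_left ?_ hc0) h3
          exact hD.le_of_le (by omega) (by omega) (by omega) (by omega)

lemma wtOf_zero : wtOf a1 a2 (fun _ => 0) = 0 := by
  simp [wtOf]

lemma wtOf_states {x : ℤ → ℤ} (hx : ZPlusMem x) {W : ℕ → ℤ → ℤ} {N : ℕ}
    (hN : ∀ k : ℤ, (N : ℤ) < k → x k = 0) (hW0 : ∀ n, N ≤ n → W n = fun _ => 0)
    (hD : ∀ n : ℕ, ∃ D, FillStep a1 a2 (n + 1) (x (n + 1)) 0 (W (n + 1)) (W n) D) :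
    wtOf a1 a2 (W 0) = wtOf a1 a2 x := by
  have hfin : x.support.Finite := (Set.finite_Icc 0 (N : ℤ)).subset fun k hk => by
    refine ⟨?_, ?_⟩ <;> by_contra h
    · exact hk (hx.1 k (by omega))
    · exact hk (hN k (by omega))
  suffices h : ∀ t n : ℕ, N ≤ n + t →
      wtOf a1 a2 (W n) = wtOf a1 a2 (fun k => if (n : ℤ) < k then x k else 0) by
    rw [h N 0 (by omega)]
    congr 1
    funext k
    split_ifs with hk
    · rfl
    · exact (hx.1 k (by simpa using hk)).symm
  intro t
  induction t with
  | zero =>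
    intro n hn
    rw [hW0 n (by omega)]
    congr 1
    funext k
    split_ifs with hk
    · exact (hN k (by omega)).symm
    · rfl
  | succ t ih =>
    intro n hn
    obtain ⟨D, hD⟩ := hD n
    have hupd : (fun k => if (n : ℤ) < k then x k else 0) =
        update (fun k => if ((n + 1 : ℕ) : ℤ) < k then x k else 0) (n + 1)
          ((fun k => if ((n + 1 : ℕ) : ℤ) < k then x k else 0) ((n : ℤ) + 1) + x (n + 1)) := by
      funext k
      by_cases hk : k = n + 1
      · subst hk; simp
      · rw [update_of_ne hk]
        split_ifs <;> first | rfl | omega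
    rw [hupd, wtOf_update, hD.wt, ih (n + 1) (by omega)]
    exact hfin.subset fun k hk => by
      intro h
      simp [h] at hk

lemma starM_zero : starM a1 a2 (fun _ => 0) = fun _ => 0 := by
  have h : ∀ n, starMChain a1 a2 (fun _ => 0) n (fun _ => 0) = fun _ => 0 := by
    intro n
    induction n with
    | zero => rfl
    | succ n ih => simpa [starMChain, eMiter] using ih
  exact h _

/-! ### Draining undoes filling -/

lemma DrainStep.tail_eq_fill {μ : ℤ × ℤ} {n m P : ℤ} {b b' R W W' D : ℤ → ℤ}
    (hR : DrainStep a1 a2 μ n P b b' R) (hD : FillStep a1 a2 n m 0 W W' D)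
    (hW : W.support.Finite) (hb : ∀ k, 1 ≤ k → b k = W' k) (k : ℤ) (hk1 : 1 ≤ k)
    (hk : k % 2 = n % 2) : R k = D k := by
  obtain ⟨M, hM⟩ := hR.tail_eventually
  obtain ⟨L, hL, hhi, -⟩ := exists_bound hW
  have hfar : ∀ j, L + 2 < j → 1 ≤ j → j % 2 = n % 2 → D j = 0 := by
    intro j hj hj1 hjn
    have h1 := hD.tail_eq (j - 2) (by omega) (by omega)
    rw [sigmaP_eq_zero fun l hl => hhi l (by omega), sub_add_cancel] at h1
    have := hD.nonneg (j - 2) (by omega) (by omega)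
    omega
  suffices h : ∀ (t : ℕ) (k : ℤ), max M (L + 2) < k + 2 * t → 1 ≤ k → k % 2 = n % 2 →
      R k = D k from h (max M (L + 2)).toNat k (by omega) hk1 hk
  intro t
  induction t with
  | zero =>
    intro k ht hk1 hk
    rw [hM k (by omega), hfar k (by omega) hk1 hk]
  | succ t ih =>
    intro k ht hk1 hk
    have h1 := hR.tail_eq k hk
    have h2 := hD.tail_eq k hk1 hk
    have h3 := hD.sigma_same k hk1 hk
    rw [ih (k + 2) (by push_cast at ht; omega) (by omega) (by omega), sigmaZ_of_pos μ hk1,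
      sigmaP_congr fun j hj => hb j (by omega)] at h1
    omega

/-! ### The constants `γ_k` -/

lemma gammaR_identities (ha1 : 1 ≤ a1) (ha2 : 1 ≤ a2) (ha : 4 < a1 * a2) :
    0 < alphaR a1 a2 ∧ 0 < betaR a1 a2 ∧ 1 ≤ alphaR a1 a2 * betaR a1 a2 ∧
      betaR a1 a2 * (a1 - alphaR a1 a2) = 1 ∧ alphaR a1 a2 * (a2 - betaR a1 a2) = 1 := by
  have h1 : (0 : ℝ) < a1 := by exact_mod_cast (by omega : 0 < a1)
  have h2 : (0 : ℝ) < a2 := by exact_mod_cast (by omega : 0 < a2)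
  have h12 : (4 : ℝ) < a1 * a2 := by exact_mod_cast ha
  unfold alphaR betaR
  set r := Real.sqrt ((a1 : ℝ) ^ 2 * (a2 : ℝ) ^ 2 - 4 * a1 * a2) with hr
  have hr0 : 0 ≤ r := Real.sqrt_nonneg _
  have hrr : r ^ 2 = (a1 : ℝ) ^ 2 * (a2 : ℝ) ^ 2 - 4 * a1 * a2 :=
    Real.sq_sqrt (by nlinarith)
  refine ⟨by positivity, by positivity, ?_, ?_, ?_⟩
  · rw [div_mul_div_comm, le_div_iff₀ (by positivity)]
    nlinarith [mul_nonneg (by linarith : (0 : ℝ) ≤ a1 * a2) hr0]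
  · field_simp
    linarith
  · field_simp
    linarith

lemma gammaR_pos (ha1 : 1 ≤ a1) (ha2 : 1 ≤ a2) (ha : 4 < a1 * a2) (k : ℤ) :
    0 < gammaR a1 a2 k := by
  obtain ⟨h1, h2, -⟩ := gammaR_identities ha1 ha2 ha
  unfold gammaR; split_ifs <;> assumption

lemma one_le_gammaR_mul (ha1 : 1 ≤ a1) (ha2 : 1 ≤ a2) (ha : 4 < a1 * a2) (k : ℤ) :
    1 ≤ gammaR a1 a2 k * gammaR a1 a2 (k + 1) := by
  obtain ⟨-, -, h, -⟩ := gammaR_identities ha1 ha2 ha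
  rcases Int.emod_two_eq_zero_or_one k with hk | hk
  · simpa [gammaR, hk, show (k + 1) % 2 = 1 by omega] using h
  · simpa [gammaR, hk, show (k + 1) % 2 = 0 by omega, mul_comm] using h

lemma gammaR_mul_sub (ha1 : 1 ≤ a1) (ha2 : 1 ≤ a2) (ha : 4 < a1 * a2) (k : ℤ) :
    gammaR a1 a2 (k + 1) * (aIdx a1 a2 (k + 1) - gammaR a1 a2 k) = 1 := by
  obtain ⟨-, -, -, h1, h2⟩ := gammaR_identities ha1 ha2 ha
  rcases Int.emod_two_eq_zero_or_one k with hk | hk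
  · simpa [gammaR, aIdx, hk, show (k + 1) % 2 = 1 by omega] using h1
  · simpa [gammaR, aIdx, hk, show (k + 1) % 2 = 0 by omega] using h2

/-! ### The inequality for defects -/

/-- A family of nonnegative integers obeying the piecewise linear recursion of the negative parts of
the elements `S_{w_n}(b)` satisfies the `γ`-inequalities: otherwise it would strictly decrease
forever. -/
lemma defect_le_gamma_mul (ha1 : 1 ≤ a1) (ha2 : 1 ≤ a2) (ha : 4 < a1 * a2) {E s : ℕ → ℤ → ℤ}
    (hmin : ∀ (n : ℕ) (k : ℤ), k % 2 = (n + 1) % 2 → E n k = min (s n k) (E n (k + 2)))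
    (hnn : ∀ (n : ℕ) (k : ℤ), k % 2 = (n + 1) % 2 → 0 ≤ E n k)
    (hrec : ∀ (n : ℕ) (k : ℤ), k % 2 = (n + 1) % 2 →
      s (n + 2) k = s n k - E n k - E n (k + 2) + aIdx a1 a2 k * E (n + 1) (k + 1))
    (hlow : ∀ n : ℕ, ∃ N : ℤ, ∀ k < N, k % 2 = (n + 1) % 2 → E n k = 0)
    (n : ℕ) (k : ℤ) (hk : k % 2 = (n + 1) % 2) :
    (E n k : ℝ) ≤ gammaR a1 a2 (n + 2) * E (n + 1) (k - 1) := by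
  have hmono : ∀ (n : ℕ) (k : ℤ), k % 2 = (n + 1) % 2 → E n k ≤ E n (k + 2) := fun n k hk => by
    rw [hmin n k hk]; exact min_le_right _ _
  have hγ : ∀ k, 0 < gammaR a1 a2 k := gammaR_pos ha1 ha2 ha
  have next : ∀ (n : ℕ) (k : ℤ), k % 2 = (n + 1) % 2 →
      gammaR a1 a2 (n + 2) * E (n + 1) (k - 1) < E n k →
      ∃ k' : ℤ, k' % 2 = (n + 2) % 2 ∧ E (n + 1) k' ≤ E (n + 1) (k - 1) ∧
        gammaR a1 a2 (n + 3) * E (n + 2) (k' - 1) < E (n + 1) k' := by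
    intro n k hk hfail
    obtain ⟨N, hN⟩ := hlow n
    obtain ⟨t, ht⟩ : ∃ t : ℕ, k - 2 * t < N := ⟨(k - N).toNat + 1, by omega⟩
    induction t generalizing k with
    | zero =>
      exfalso
      rw [hN k (by simpa using ht) hk] at hfail
      have h1 : (0 : ℝ) ≤ E (n + 1) (k - 1) := by
        exact_mod_cast hnn (n + 1) (k - 1) (by push_cast; omega)
      have := mul_nonneg (hγ (n + 2)).le h1
      simp at hfail
      linarith
    | succ t ih =>
      have hm := hmono (n + 1) (k - 3) (by push_cast; omega)
      rw [show k - 3 + 2 = k - 1 by ring] at hm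
      have h1 := hmin n (k - 2) (by omega)
      rw [sub_add_cancel] at h1
      by_cases heq : E n (k - 2) = E n k
      · obtain ⟨k', hk', hle, hf⟩ := ih (k - 2) (by omega) (by
          rw [heq, show k - 2 - 1 = k - 3 by ring]
          refine lt_of_le_of_lt (mul_le_mul_of_nonneg_left ?_ (hγ _).le) hfail
          exact_mod_cast hm) (by push_cast at ht; omega)
        exact ⟨k', hk', hle.trans (by rwa [show k - 2 - 1 = k - 3 by ring]), hf⟩
      · refine ⟨k - 1, by omega, le_rfl, ?_⟩
        have h2 := hrec n (k - 2) (by omega)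
        have h3 := hmin (n + 2) (k - 2) (by push_cast; omega)
        rw [sub_add_cancel, show k - 2 + 1 = k - 1 by ring] at h2
        have h4 : E (n + 2) (k - 2) ≤ aIdx a1 a2 (k - 2) * E (n + 1) (k - 1) - E n k := by
          omega
        rw [aIdx_congr (show (k - 2) % 2 = ((n : ℤ) + 2 + 1) % 2 by omega)] at h4
        have h5 : (E (n + 2) (k - 2) : ℝ) ≤
            aIdx a1 a2 (n + 2 + 1) * E (n + 1) (k - 1) - E n k := by exact_mod_cast h4
        have h6 := gammaR_mul_sub ha1 ha2 ha (n + 2)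
        rw [show k - 1 - 1 = k - 2 by ring, show (n : ℤ) + 3 = n + 2 + 1 by ring]
        have h7 : (E (n + 2) (k - 2) : ℝ) <
            (aIdx a1 a2 (n + 2 + 1) - gammaR a1 a2 (n + 2)) * E (n + 1) (k - 1) := by linarith
        calc _ < gammaR a1 a2 (n + 2 + 1) *
              ((aIdx a1 a2 (n + 2 + 1) - gammaR a1 a2 (n + 2)) * E (n + 1) (k - 1)) :=
              mul_lt_mul_of_pos_left h7 (hγ _)
          _ = _ := by rw [← mul_assoc, h6, one_mul]
  obtain ⟨v, hv⟩ : ∃ v : ℕ, E n k = v := ⟨(E n k).toNat, by have := hnn n k hk; omega⟩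
  induction v using Nat.strong_induction_on generalizing n k with
  | _ v ih =>
    by_contra hfail
    rw [not_le] at hfail
    obtain ⟨k', hk', hle', hf'⟩ := next n k hk hfail
    obtain ⟨k'', hk'', hle'', hf''⟩ := next (n + 1) k' (by push_cast; omega) (by
      push_cast; rwa [show (n : ℤ) + 1 + 2 = n + 3 by ring])
    have hlt : E (n + 2) k'' < E n k := by
      have h1 : (E (n + 2) k'' : ℝ) ≤ E (n + 2) (k' - 1) := by exact_mod_cast hle''
      have h2 : (E (n + 1) k' : ℝ) ≤ E (n + 1) (k - 1) := by exact_mod_cast hle'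
      have h0 : (0 : ℝ) ≤ E (n + 2) k'' := by
        exact_mod_cast hnn (n + 2) k'' (by push_cast at hk'' ⊢; omega)
      have h3 := one_le_gammaR_mul ha1 ha2 ha (n + 2)
      rw [show (n : ℤ) + 2 + 1 = n + 3 by ring] at h3
      have h4 : gammaR a1 a2 (n + 3) * E (n + 2) k'' < E (n + 1) (k - 1) :=
        lt_of_le_of_lt (mul_le_mul_of_nonneg_left h1 (hγ _).le) (hf'.trans_le h2)
      have h5 := mul_lt_mul_of_pos_left h4 (hγ (n + 2))
      have h6 := mul_le_mul_of_nonneg_right h3 h0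
      have : (E (n + 2) k'' : ℝ) < E n k := by linarith
      exact_mod_cast this
    have hnn'' := hnn (n + 2) k'' (by push_cast at hk'' ⊢; omega)
    have := ih (E (n + 2) k'').toNat (by omega) (n + 2) k'' (by push_cast at hk'' ⊢; omega)
      (by omega)
    push_cast at this hf''
    rw [show (n : ℤ) + 2 + 2 = n + 1 + 3 by ring] at this
    exact absurd hf'' (not_lt.2 this)

/-! ### The extremal orbit -/

lemma exists_drainStep_of_SiO {μ : ℤ × ℤ} {n P : ℤ} {b b' : ℤ → ℤ} (hb : b.support.Finite)
    (hP : 0 < P) (hpair : pairW (wtZ a1 a2 μ b) (idx n) = -P) (hf : fZ a1 a2 μ (idx n) b = none)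
    (hS : SiO a1 a2 μ (idx n) (some b) = some b') :
    ∃ R, DrainStep a1 a2 μ n P b b' R := by
  have hPn : ((P.toNat : ℕ) : ℤ) = P := Int.toNat_of_nonneg hP.le
  obtain ⟨N, hN, -, hlo⟩ := exists_bound hb
  obtain ⟨c, R, hc, hR⟩ := exists_drainStep (a1 := a1) (a2 := a2) μ n P.toNat b hb
    (fun k hk => by
      have := sigmaZ_le_of_fZ_eq_none hb hf ((idx_eq_iff k n).2 hk)
      omega)
    (by
      obtain ⟨k, hk, hkN⟩ : ∃ k : ℤ, k % 2 = n % 2 ∧ k < -N :=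
        ⟨n % 2 - 2 * (N + 1), by omega, by omega⟩
      refine ⟨k, hk, ?_⟩
      rw [sigmaZ_of_low μ (by omega) fun j hj => hlo j (by omega), (idx_eq_iff k n).2 hk, hpair]
      omega)
  rw [SiO, Option.bind_some, hpair, if_neg (by omega), neg_neg, hc, Option.some_inj] at hS
  rw [hPn, hS] at hR
  exact ⟨R, hR⟩

lemma DrainStep.tail_eq_of_low {μ : ℤ × ℤ} {n P : ℤ} {b b' R : ℤ → ℤ}
    (hR : DrainStep a1 a2 μ n P b b' R) (hb : b.support.Finite)
    (hpair : pairW (wtZ a1 a2 μ b) (idx n) = -P) :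
    ∃ N, ∀ k < N, k % 2 = n % 2 → R k = P := by
  obtain ⟨N, hN, -, hlo⟩ := exists_bound hb
  refine ⟨-N, fun k hk hkn => ?_⟩
  have h1 := sigmaZ_of_low (a1 := a1) (a2 := a2) μ (by omega : k ≤ 0) fun j hj => hlo j (by omega)
  rw [(idx_eq_iff k n).2 hkn, hpair, neg_neg] at h1
  have h2 := hR.tail_eq k hkn
  have h3 := hR.tail_le k hkn
  omega

lemma DrainStep.pairW_eq {μ : ℤ × ℤ} {n P : ℤ} {b b' R : ℤ → ℤ}
    (hR : DrainStep a1 a2 μ n P b b' R) (hb : b.support.Finite)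
    (hpair : pairW (wtZ a1 a2 μ b) (idx n) = -P) :
    pairW (wtZ a1 a2 μ b') (idx n) = P ∧
      pairW (wtZ a1 a2 μ b') (idx (n + 1)) =
        pairW (wtZ a1 a2 μ b) (idx (n + 1)) - aIdx a1 a2 (n + 1) * P := by
  obtain ⟨M, hM⟩ := hR.tail_eq_of_low hb hpair
  obtain ⟨N, hN, -, hlo⟩ := exists_bound hb
  obtain ⟨N', hN', -, hlo'⟩ := exists_bound hR.finite
  obtain ⟨k, hkn, hkM, hkN, hkN'⟩ :
      ∃ k : ℤ, k % 2 = n % 2 ∧ k + 2 < M ∧ k + 2 < -N ∧ k + 2 < -N' :=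
    ⟨n % 2 - 2 * (max (-M) 0 + N + N' + 3), by omega, by omega, by omega, by omega⟩
  have low : ∀ j, j ≤ k + 2 → sigmaZ a1 a2 μ b j = -pairW (wtZ a1 a2 μ b) (idx j) := fun j hj =>
    sigmaZ_of_low μ (by omega) fun l hl => hlo l (by omega)
  have low' : ∀ j, j ≤ k + 2 → sigmaZ a1 a2 μ b' j = -pairW (wtZ a1 a2 μ b') (idx j) :=
    fun j hj => sigmaZ_of_low μ (by omega) fun l hl => hlo' l (by omega)
  have h1 := hR.sigma_same k hkn
  have h2 := hR.sigma_other (k + 1) (by omega)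
  rw [low _ (by omega), low' _ (by omega), (idx_eq_iff k n).2 hkn, hM k (by omega) hkn,
    hM (k + 2) (by omega) (by omega), hpair] at h1
  rw [low _ (by omega), low' _ (by omega), (idx_eq_iff (k + 1) (n + 1)).2 (by omega),
    aIdx_congr (show (k + 1) % 2 = (n + 1) % 2 by omega), show k + 1 + 1 = k + 2 by ring,
    hM (k + 2) (by omega) (by omega)] at h2
  constructor <;> linarith

lemma isI_idx (k : ℤ) : IsI (idx k) := by
  unfold IsI idx; split_ifs <;> simp

lemma Extremal.exists_orbit {μ : ℤ × ℤ} {c : ℤ → ℤ} (h : Extremal a1 a2 μ c) :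
    ∃ b : ℕ → ℤ → ℤ, b 0 = c ∧
      (∀ n : ℕ, SiO a1 a2 μ (idx (n + 1)) (some (b n)) = some (b (n + 1))) ∧
      ∀ (n : ℕ) (k : ℤ), pairW (wtZ a1 a2 μ (b n)) (idx k) ≤ 0 →
        fZ a1 a2 μ (idx k) (b n) = none := by
  let js : ℕ → List ℤ := fun n => Nat.rec [] (fun n l => idx (n + 1) :: l) n
  have hjs : ∀ n, js (n + 1) = idx (n + 1) :: js n := fun n => rfl
  have hI : ∀ n, ∀ j ∈ js n, IsI j := by
    intro n
    induction n with
    | zero => intro j hj; cases hj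
    | succ n ih =>
      intro j hj
      rw [hjs, List.mem_cons] at hj
      rcases hj with rfl | hj
      · exact isI_idx _
      · exact ih j hj
  choose b hb hbe using fun n => h (js n) (hI n)
  refine ⟨b, ?_, fun n => ?_, fun n k hk => (hbe n _ (isI_idx k)).2 hk⟩
  · exact (Option.some_inj.1 (hb 0)).symm
  · rw [← hb n, ← hb (n + 1), hjs, List.foldr_cons]

/-- Along an extremal orbit starting from `W 0`, applying `S_{i_{n+1}}` undoes the `n`-th filling
step on the positive coordinates. -/
lemma exists_drainSteps {k1 k2 : ℤ} (hp : ∀ m, 0 < ppos a1 a2 k1 k2 m) {μ : ℤ × ℤ}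
    {b W D : ℕ → ℤ → ℤ} {m : ℕ → ℤ}
    (hS : ∀ n : ℕ, SiO a1 a2 μ (idx (n + 1)) (some (b n)) = some (b (n + 1)))
    (hf : ∀ (n : ℕ) (k : ℤ), pairW (wtZ a1 a2 μ (b n)) (idx k) ≤ 0 →
      fZ a1 a2 μ (idx k) (b n) = none)
    (hD : ∀ n : ℕ, FillStep a1 a2 (n + 1) (m n) 0 (W (n + 1)) (W n) (D n)) (h0 : b 0 = W 0)
    (hwt0 : pairW (wtZ a1 a2 μ (b 0)) (idx 0) = k2)
    (hwt1 : pairW (wtZ a1 a2 μ (b 0)) (idx 1) = -k1) :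
    ∃ R : ℕ → ℤ → ℤ, ∀ n : ℕ,
      DrainStep a1 a2 μ (n + 1) (ppos a1 a2 k1 k2 (n + 1)) (b n) (b (n + 1)) (R n) ∧
      (∃ N, ∀ k < N, k % 2 = ((n : ℤ) + 1) % 2 → R n k = ppos a1 a2 k1 k2 (n + 1)) ∧
      ∀ k, 1 ≤ k → k % 2 = ((n : ℤ) + 1) % 2 → R n k = D n k := by
  have step : ∀ n : ℕ, (b n).support.Finite → (∀ k, 1 ≤ k → b n k = W n k) →
      pairW (wtZ a1 a2 μ (b n)) (idx (n + 1)) = -ppos a1 a2 k1 k2 (n + 1) →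
      ∃ R : ℤ → ℤ,
        DrainStep a1 a2 μ (n + 1) (ppos a1 a2 k1 k2 (n + 1)) (b n) (b (n + 1)) R ∧
        (∃ N, ∀ k < N, k % 2 = ((n : ℤ) + 1) % 2 → R k = ppos a1 a2 k1 k2 (n + 1)) ∧
        ∀ k, 1 ≤ k → k % 2 = ((n : ℤ) + 1) % 2 → R k = D n k := by
    intro n hfin hpos hpair
    have hP := hp (n + 1)
    obtain ⟨R, hR⟩ := exists_drainStep_of_SiO hfin hP hpair (hf n _ (by omega)) (hS n)
    exact ⟨R, hR, hR.tail_eq_of_low hfin hpair,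
      hR.tail_eq_fill (hD n) (hD (n + 1)).finite hpos⟩
  have inv : ∀ n : ℕ, (b n).support.Finite ∧ (∀ k, 1 ≤ k → b n k = W n k) ∧
      pairW (wtZ a1 a2 μ (b n)) (idx (n + 1)) = -ppos a1 a2 k1 k2 (n + 1) ∧
      pairW (wtZ a1 a2 μ (b n)) (idx n) = ppos a1 a2 k1 k2 n := by
    intro n
    induction n with
    | zero =>
      refine ⟨h0 ▸ (hD 0).finite, fun k _ => by rw [h0], ?_, ?_⟩
      · simpa [ppos] using hwt1
      · simpa [ppos] using hwt0
    | succ n ih =>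
      obtain ⟨hfin, hpos, hpair, hpair'⟩ := ih
      obtain ⟨R, hR, -, hRD⟩ := step n hfin hpos hpair
      obtain ⟨hw1, hw2⟩ := hR.pairW_eq hfin hpair
      refine ⟨hR.finite, fun k hk => ?_, ?_, by exact_mod_cast hw1⟩
      · by_cases hc : k % 2 = ((n : ℤ) + 1) % 2
        · have h1 := hR.coord_same k hc
          have h2 := (hD n).coord_same k hk hc
          rw [hRD k hk hc, hRD (k + 2) (by omega) (by omega), hpos k hk] at h1
          omega
        · rw [hR.coord_other k hc, hpos k hk, (hD n).coord_other k hc]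
      · have h1 := ppos_add_two (a1 := a1) (a2 := a2) k1 k2 n
        rw [(idx_eq_iff ((n : ℤ) + 1 + 1) n).2 (by omega), hpair',
          aIdx_congr (show ((n : ℤ) + 1 + 1) % 2 = n % 2 by omega)] at hw2
        push_cast
        rw [(idx_eq_iff ((n : ℤ) + 1 + 1) n).2 (by omega), hw2, h1]
        ring
  choose R hR using fun n => step n (inv n).1 (inv n).2.1 (inv n).2.2.1
  exact ⟨R, hR⟩

lemma gamma_ineq_of_drainSteps (ha1 : 1 ≤ a1) (ha2 : 1 ≤ a2) (ha : 4 < a1 * a2) {k1 k2 : ℤ}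
    {μ : ℤ × ℤ} {b R : ℕ → ℤ → ℤ}
    (hR : ∀ n : ℕ, DrainStep a1 a2 μ (n + 1) (ppos a1 a2 k1 k2 (n + 1)) (b n) (b (n + 1)) (R n))
    (hlow : ∀ n : ℕ, ∃ N, ∀ k < N, k % 2 = ((n : ℤ) + 1) % 2 →
      R n k = ppos a1 a2 k1 k2 (n + 1))
    (n : ℕ) (k : ℤ) (hk : k % 2 = ((n : ℤ) + 1) % 2) :
    ((ppos a1 a2 k1 k2 (n + 1) - R n k : ℤ) : ℝ) ≤
      gammaR a1 a2 (n + 2) * ((ppos a1 a2 k1 k2 (n + 2) - R (n + 1) (k - 1) : ℤ) : ℝ) := by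
  refine defect_le_gamma_mul ha1 ha2 ha (E := fun n k => ppos a1 a2 k1 k2 (n + 1) - R n k)
    (s := fun n k => ppos a1 a2 k1 k2 (n + 1) - sigmaZ a1 a2 μ (b n) k) ?_ ?_ ?_ ?_ n k hk
  · intro n k hk
    have := (hR n).tail_eq k hk
    omega
  · intro n k hk
    have := (hR n).tail_le k hk
    omega
  · intro n k hk
    have h1 := (hR n).sigma_same k hk
    have h2 := (hR (n + 1)).sigma_other k (by push_cast; omega)
    have h3 := ppos_add_two (a1 := a1) (a2 := a2) k1 k2 (n + 1)
    rw [aIdx_congr (show ((n + 1 : ℕ) : ℤ) % 2 = k % 2 by push_cast; omega)] at h3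
    show ppos a1 a2 k1 k2 (n + 1 + 2) - sigmaZ a1 a2 μ (b (n + 1 + 1)) k = _
    rw [h3, h2, h1]
    ring
  · intro n
    obtain ⟨N, hN⟩ := hlow n
    exact ⟨N, fun k hk hkn => by rw [hN k hk hkn, sub_self]⟩

end HypCrystal

open HypCrystal in
theorem extremal_implies_gamma_p_ineq
    (a1 a2 : ℤ) (ha1 : 1 ≤ a1) (ha2 : 1 ≤ a2) (ha : 4 < a1 * a2)
    (k1 k2 : ℤ) (hk1 : 0 < k1) (hk2 : 0 < k2)
    (hreg : 2 ≤ a1 → 2 ≤ a2 →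
      (k2 ≤ k1 ∧ k1 < (a1 - 1) * k2) ∨ (k1 < k2 ∧ k2 ≤ (a2 - 1) * k1))
    (hdeg1 : a1 = 1 → 2 * k1 ≤ k2 ∧ k2 ≤ (a2 - 2) * k1)
    (hdeg2 : a2 = 1 → 2 * k2 ≤ k1 ∧ k1 ≤ (a1 - 2) * k2)
    (x : ℤ → ℤ) (hx : XPlusMem a1 a2 x)
    (hext : Extremal a1 a2 (mustar a1 a2 (lamW k1 k2) x) (xstarFun a1 a2 x)) :
    ∀ k : ℤ, 1 ≤ k →
      0 ≤ gammaR a1 a2 (k + 1) * (pseq a1 a2 k1 k2 (k + 1) : ℝ) -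
          (pseq a1 a2 k1 k2 k : ℝ) + (x k : ℝ) -
          gammaR a1 a2 (k + 1) * (x (k + 1) : ℝ) := by
  obtain ⟨W, N, hWstar, hN, hW0, hW⟩ := exists_states (a1 := a1) (a2 := a2) hx.1
  have hD := exists_fillStep_states ha1 ha2 ha hx hN hW0 hW
  have hwtW : wtOf a1 a2 (W 0) = wtOf a1 a2 x := wtOf_states hx.1 hN hW0 hD
  choose D hD using hD
  obtain ⟨b, hb0, hS, hf⟩ := hext.exists_orbit
  have hpos : HypCrystal.posPart x = x := by
    funext k
    by_cases h : 1 ≤ k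
    · simp [HypCrystal.posPart, h]
    · simp [HypCrystal.posPart, h, hx.1.1 k (by omega)]
  have hneg : HypCrystal.negPart x = fun _ => 0 := by
    funext k
    by_cases h : k ≤ 0
    · simp [HypCrystal.negPart, h, hx.1.1 k h]
    · simp [HypCrystal.negPart, h]
  have hWlow : ∀ k ≤ 0, W 0 k = 0 := by
    intro k hk
    have h : ∀ n, W 0 k = W n k := by
      intro n
      induction n with
      | zero => rfl
      | succ n ih => rw [ih, (hD n).coord_low k hk]
    rw [h N, hW0 N le_rfl]
  have hstart : b 0 = W 0 := by
    rw [hb0, xstarFun, hpos, hneg, starM_zero, hWstar]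
    funext k
    by_cases h : 1 ≤ k
    · simp [combine, h]
    · simp [combine, h, hWlow k (by omega)]
  have hwt : wtZ a1 a2 (mustar a1 a2 (lamW k1 k2) x) (b 0) = (-k1, k2) := by
    rw [wtZ, mustar, hpos, hneg, wtOf_zero, hstart, hwtW]
    simp [lamW]
  obtain ⟨R, hR⟩ := exists_drainSteps
    (ppos_pos ha1 ha2 ha hk1 hk2 hreg hdeg1 hdeg2) hS hf hD hstart
    (by rw [hwt]; simp [pairW, idx]) (by rw [hwt]; simp [pairW, idx])
  have hineq := gamma_ineq_of_drainSteps ha1 ha2 ha (fun n => (hR n).1) fun n => (hR n).2.1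
  have hstartR : ∀ (n : ℕ) (k : ℤ), 1 ≤ k → k ≤ 2 → k % 2 = ((n : ℤ) + 1) % 2 →
      R n k = x (n + 1) := fun n k h1 h2 hk => by
    rw [(hR n).2.2 k h1 hk, (hD n).tail_start k h1 h2 hk]
  intro k hk
  obtain ⟨n, rfl⟩ : ∃ n : ℕ, k = n + 1 := ⟨(k - 1).toNat, by omega⟩
  obtain ⟨j, hj1, hj2, hjn⟩ : ∃ j : ℤ, 1 ≤ j ∧ j ≤ 2 ∧ j % 2 = ((n : ℤ) + 1) % 2 :=
    ⟨2 - ((n : ℤ) + 1) % 2, by omega, by omega, by omega⟩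
  have hnext : x (n + 2) ≤ R (n + 1) (j - 1) := by
    by_cases h : j = 2
    · have := hstartR (n + 1) (j - 1) (by omega) (by omega) (by push_cast; omega)
      push_cast at this
      rw [this, add_assoc]; rfl
    · have h1 := hstartR (n + 1) (j + 1) (by omega) (by omega) (by push_cast; omega)
      have h2 := (hR (n + 1)).1.tail_eq (j - 1) (by push_cast; omega)
      push_cast at h1
      rw [show j - 1 + 2 = j + 1 by ring, h1, show (n : ℤ) + 1 + 1 = n + 2 by ring] at h2
      omega
  have h := hineq n j hjn
  rw [hstartR n j hj1 hj2 hjn] at h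
  have hγ := gammaR_pos ha1 ha2 ha (n + 2)
  have hle : ((ppos a1 a2 k1 k2 (n + 2) - R (n + 1) (j - 1) : ℤ) : ℝ) ≤
      ((ppos a1 a2 k1 k2 (n + 2) - x (n + 2) : ℤ) : ℝ) := by
    exact_mod_cast sub_le_sub_left hnext _
  have h' := h.trans (mul_le_mul_of_nonneg_left hle hγ.le)
  push_cast at h'
  have hp1 : pseq a1 a2 k1 k2 (n + 1) = ppos a1 a2 k1 k2 (n + 1) := by
    rw [pseq, if_pos (by omega)]
    congr 1
  have hp2 : pseq a1 a2 k1 k2 (n + 1 + 1) = ppos a1 a2 k1 k2 (n + 2) := by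
    rw [pseq, if_pos (by omega)]
    congr 1
  rw [hp1, hp2, show (n : ℤ) + 1 + 1 = n + 2 by ring]
  linarith
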